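/- Let k, l, m, n be integers with k, m, n positive and l ≥ 0, satisfying (k + 2(l+1))/n + (l+1)/m + k(l+1)/(mn) < 1. Then there is no transcendental meromorphic function H on ℂ such that H(0) ≠ 0, all zeros of H have multiplicity at least n, all non-zero poles of H have multiplicity at least n, and all zeros of H^{(k)}(ζ) − ζ^l have multiplicity at least m. -/

import Mathlib

open Complex Topology Filter Set MeasureTheory
open scoped ENNReal NNReal Classical

noncomputable section


/-- The chordal (spherical) distance on the Riemann sphere `ℂ ∪ {∞}`. -/
def sphDist (a b : OnePoint ℂ) : ℝ :=
  Option.elim a (Option.elim b 0 fun w => 1 / Real.sqrt (1 + ‖w‖ ^ 2))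
    fun z => Option.elim b (1 / Real.sqrt (1 + ‖z‖ ^ 2))
      fun w => ‖z - w‖ / (Real.sqrt (1 + ‖z‖ ^ 2) * Real.sqrt (1 + ‖w‖ ^ 2))

/-- The natural Riemann-sphere-valued version of a meromorphic function:
at points where the function blows up (poles) the value is `∞`. -/
def toSphere (f : ℂ → ℂ) : ℂ → OnePoint ℂ := fun z =>
  if Tendsto (fun w => ‖f w‖) (𝓝[≠] z) atTop then OnePoint.infty else (f z : OnePoint ℂ)

/-- A meromorphic function given by an honest representative: at each point of `D` it is
either continuous (analytic points) or blows up (a pole). -/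
def MeromorphicNiceOn (f : ℂ → ℂ) (D : Set ℂ) : Prop :=
  MeromorphicOn f D ∧ ∀ z ∈ D, ContinuousAt f z ∨ Tendsto (fun w => ‖f w‖) (𝓝[≠] z) atTop

/-- The order (multiplicity) of a meromorphic function at a point: positive for a zero of that
multiplicity, negative of the multiplicity for a pole, `⊤` if the function vanishes identically
near the point, and junk value `0` when not defined. -/
def merOrder (f : ℂ → ℂ) (z : ℂ) : WithTop ℤ :=
  if ∀ᶠ w in 𝓝[≠] z, f w = 0 then ⊤
  else if h : ∃ n : ℤ, ∃ g : ℂ → ℂ, AnalyticAt ℂ g z ∧ g z ≠ 0 ∧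
      ∀ᶠ w in 𝓝[≠] z, f w = (w - z) ^ n * g w
    then (h.choose : WithTop ℤ) else 0

/-- `F j → g` spherically uniformly on compact subsets of `D`. -/
def ConvSphLocUnif (F : ℕ → ℂ → ℂ) (g : ℂ → ℂ) (D : Set ℂ) : Prop :=
  ∀ K ⊆ D, IsCompact K → ∀ ε > 0, ∀ᶠ j in atTop, ∀ z ∈ K,
    sphDist (toSphere (F j) z) (toSphere g z) < ε

/-- `F j → ∞` spherically uniformly on compact subsets of `D`. -/
def ConvInftyLocUnif (F : ℕ → ℂ → ℂ) (D : Set ℂ) : Prop :=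
  ∀ K ⊆ D, IsCompact K → ∀ ε > 0, ∀ᶠ j in atTop, ∀ z ∈ K,
    sphDist (toSphere (F j) z) OnePoint.infty < ε

/-- A family of meromorphic functions is normal in `D` if every sequence from the family has a
subsequence converging spherically uniformly on compact subsets of `D` to a meromorphic
function or to `∞`. -/
def NormalFamilyOn (𝓕 : Set (ℂ → ℂ)) (D : Set ℂ) : Prop :=
  ∀ f : ℕ → ℂ → ℂ, (∀ j, f j ∈ 𝓕) → ∃ φ : ℕ → ℕ, StrictMono φ ∧
    ((∃ g : ℂ → ℂ, MeromorphicNiceOn g D ∧ ConvSphLocUnif (fun j => f (φ j)) g D) ∨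
      ConvInftyLocUnif (fun j => f (φ j)) D)

/-- A sequence of meromorphic functions is normal in `D` if every subsequence has a further
subsequence converging spherically uniformly on compact subsets of `D` to a meromorphic
function or to `∞`. -/
def NormalSeqOn (f : ℕ → ℂ → ℂ) (D : Set ℂ) : Prop :=
  ∀ φ : ℕ → ℕ, StrictMono φ → ∃ σ : ℕ → ℕ, StrictMono σ ∧
    ((∃ g : ℂ → ℂ, MeromorphicNiceOn g D ∧ ConvSphLocUnif (fun j => f (φ (σ j))) g D) ∨
      ConvInftyLocUnif (fun j => f (φ (σ j))) D)

/-- A circle average is bounded in norm by the circle average of any integrable majorant. -/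
theorem norm_circleAverage_le_of_norm_le {E : Type*} [NormedAddCommGroup E] [NormedSpace ℝ E]
    {f : ℂ → E} {b : ℂ → ℝ} {c : ℂ} {R : ℝ} (hb : CircleIntegrable b c R)
    (h : ∀ z ∈ Metric.sphere c |R|, ‖f z‖ ≤ b z) :
    ‖Real.circleAverage f c R‖ ≤ Real.circleAverage b c R := by
  rw [Real.circleAverage_def, Real.circleAverage_def, norm_smul, smul_eq_mul, Real.norm_eq_abs,
    abs_of_nonneg (by positivity)]
  gcongr
  exact intervalIntegral.norm_integral_le_of_norm_le Real.two_pi_pos.le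
    (Eventually.of_forall fun θ _ ↦ h _ (circleMap_mem_sphere' c R θ)) hb

/-- Borel–Carathéodory type estimate: the logarithmic derivative of a zero-free function is
controlled by the circle average of `|log ‖g‖|`. -/
theorem norm_logDeriv_le_circleAverage {g : ℂ → ℂ} {R : ℝ} {z : ℂ}
    (hg : ∀ w ∈ Metric.closedBall (0 : ℂ) R, AnalyticAt ℂ g w)
    (hg0 : ∀ w ∈ Metric.closedBall (0 : ℂ) R, g w ≠ 0) (hz : ‖z‖ < R) :
    ‖logDeriv g z‖ ≤
      2 * R / (R - ‖z‖) ^ 2 * Real.circleAverage (fun w ↦ |Real.log ‖g w‖|) 0 R := by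
  have hR : 0 < R := (norm_nonneg z).trans_lt hz
  have hzb : z ∈ Metric.ball (0 : ℂ) R := by simpa using hz
  have hsub : ∀ w ∈ Metric.sphere (0 : ℂ) |R|, w ∈ Metric.closedBall (0 : ℂ) R := fun w hw ↦ by
    rw [abs_of_pos hR] at hw; exact Metric.sphere_subset_closedBall hw
  have hcont : ContinuousOn (fun w ↦ Real.log ‖g w‖) (Metric.sphere (0 : ℂ) |R|) := fun w hw ↦
    ((hg w (hsub w hw)).continuousAt.norm.log
      (norm_ne_zero_iff.2 (hg0 w (hsub w hw)))).continuousWithinAt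
  have hint : CircleIntegrable (fun w ↦ Real.log ‖g w‖) 0 R := hcont.circleIntegrable'
  have hintc : CircleIntegrable (fun w ↦ ((Real.log ‖g w‖ : ℝ) : ℂ)) 0 R :=
    (Complex.continuous_ofReal.comp_continuousOn hcont).circleIntegrable'
  have hharm : InnerProductSpace.HarmonicOnNhd (fun w ↦ Real.log ‖g w‖)
      (Metric.closedBall (0 : ℂ) R) := fun w hw ↦ (hg w hw).harmonicAt_log_norm (hg0 w hw)
  set Φ : ℂ → ℂ := fun w ↦ Real.circleAverage
    (fun ζ ↦ herglotzRieszKernel 0 w ζ • ((Real.log ‖g ζ‖ : ℝ) : ℂ)) 0 R with hΦ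
  have hd : ∀ w ∈ Metric.ball (0 : ℂ) R, HasDerivAt Φ (Real.circleAverage
      (fun ζ ↦ (2 * ζ / (ζ - w) ^ 2) • ((Real.log ‖g ζ‖ : ℝ) : ℂ)) 0 R) w := fun w hw ↦
    hasDerivAt_circleAverage_herglotzRieszKernel_smul hintc hw
  have hre : ∀ w ∈ Metric.ball (0 : ℂ) R, (Φ w).re = Real.log ‖g w‖ := fun w hw ↦ by
    rw [hΦ]
    simp only
    rw [re_circleAverage_herglotzRieszKernel_smul hint hw]
    exact InnerProductSpace.HarmonicOnNhd.circleAverage_re_herglotzRieszKernel_smul hharm hw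
  have hgd : ∀ w ∈ Metric.ball (0 : ℂ) R, HasDerivAt g (deriv g w) w := fun w hw ↦
    (hg w (Metric.ball_subset_closedBall hw)).differentiableAt.hasDerivAt
  set h : ℂ → ℂ := fun w ↦ g w * cexp (-Φ w) with hh
  have hhd : ∀ w ∈ Metric.ball (0 : ℂ) R, HasDerivAt h _ w := fun w hw ↦
    (hgd w hw).mul ((hd w hw).neg.cexp)
  have hnorm : ∀ w ∈ Metric.ball (0 : ℂ) R, ‖h w‖ = 1 := fun w hw ↦ by
    have hp : 0 < ‖g w‖ := norm_pos_iff.2 (hg0 w (Metric.ball_subset_closedBall hw))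
    rw [hh]
    simp only [norm_mul, Complex.norm_exp, Complex.neg_re, hre w hw, Real.exp_neg,
      Real.exp_log hp]
    exact mul_inv_cancel₀ hp.ne'
  have hconst := Complex.eqOn_of_isPreconnected_of_isMaxOn_norm
    (convex_ball (0 : ℂ) R).isPreconnected Metric.isOpen_ball
    (fun w hw ↦ (hhd w hw).differentiableAt.differentiableWithinAt) hzb
    (fun w hw ↦ by simp [hnorm w hw, hnorm z hzb])
  have hd0 : HasDerivAt h 0 z := (hasDerivAt_const z (h z)).congr_of_eventuallyEq
    (hconst.eventuallyEq_of_mem (Metric.isOpen_ball.mem_nhds hzb))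
  have key := (hhd z hzb).unique hd0
  have hgz : g z ≠ 0 := hg0 z (Metric.ball_subset_closedBall hzb)
  have hlog : logDeriv g z = Real.circleAverage
      (fun ζ ↦ (2 * ζ / (ζ - z) ^ 2) • ((Real.log ‖g ζ‖ : ℝ) : ℂ)) 0 R := by
    rw [logDeriv_apply, div_eq_iff hgz]
    have he := Complex.exp_ne_zero (-Φ z)
    apply mul_right_cancel₀ he
    linear_combination key
  rw [hlog, ← smul_eq_mul, ← Real.circleAverage_smul]
  refine norm_circleAverage_le_of_norm_le
    (hcont.abs.const_smul _).circleIntegrable' fun ζ hζ ↦ ?_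
  rw [norm_smul, Complex.norm_real, Real.norm_eq_abs, Pi.smul_apply, smul_eq_mul]
  gcongr
  have hζ' : ‖ζ‖ = R := by simpa [abs_of_pos hR] using hζ
  rw [norm_div, norm_mul, norm_pow, hζ']
  have : R - ‖z‖ ≤ ‖ζ - z‖ := by rw [← hζ']; exact norm_sub_norm_le ζ z
  have h0 : 0 < R - ‖z‖ := sub_pos.2 hz
  simp only [Complex.norm_ofNat]
  gcongr

theorem intervalIntegrable_sqrt_inv_abs_sin (a b : ℝ) :
    IntervalIntegrable (fun θ : ℝ ↦ √(|Real.sin θ|⁻¹)) volume a b := by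
  have hper : Function.Periodic (fun θ : ℝ ↦ √(|Real.sin θ|⁻¹)) Real.pi := fun θ ↦ by
    simp only [Real.sin_add_pi, abs_neg]
  have hmeas : Measurable (fun θ : ℝ ↦ √(|Real.sin θ|⁻¹)) := by fun_prop
  have h1 : IntervalIntegrable (fun θ : ℝ ↦ √(|Real.sin θ|⁻¹)) volume 0 (Real.pi / 2) := by
    have hb : IntervalIntegrable (fun θ : ℝ ↦ √(Real.pi / 2) * θ ^ (-(1 / 2) : ℝ)) volume 0
        (Real.pi / 2) := (intervalIntegral.intervalIntegrable_rpow' (by norm_num)).const_mul _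
    refine hb.mono_fun' hmeas.aestronglyMeasurable ?_
    refine (ae_restrict_iff' measurableSet_uIoc).2 (Eventually.of_forall fun θ hθ ↦ ?_)
    rw [uIoc_of_le Real.pi_div_two_pos.le] at hθ
    have h0 : 0 < θ := hθ.1
    have hs := Real.mul_abs_le_abs_sin (x := θ) (by rw [abs_of_pos h0]; exact hθ.2)
    rw [abs_of_pos h0] at hs
    have hpos : 0 < 2 / Real.pi * θ := mul_pos (div_pos two_pos Real.pi_pos) h0
    simp only [Real.norm_of_nonneg (Real.sqrt_nonneg _)]
    rw [Real.rpow_neg h0.le, ← Real.sqrt_eq_rpow,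
      ← Real.sqrt_inv, ← Real.sqrt_mul (by positivity)]
    apply Real.sqrt_le_sqrt
    calc |Real.sin θ|⁻¹ ≤ (2 / Real.pi * θ)⁻¹ := inv_anti₀ hpos hs
      _ = Real.pi / 2 * θ⁻¹ := by rw [mul_inv, inv_div]
  have h2 : IntervalIntegrable (fun θ : ℝ ↦ √(|Real.sin θ|⁻¹)) volume (-(Real.pi / 2)) 0 := by
    have := (IntervalIntegrable.iff_comp_neg (by simp)).1 h1
    simp only [Real.sin_neg, abs_neg, neg_zero] at this
    exact this.symm
  refine hper.intervalIntegrable (t := -(Real.pi / 2)) Real.pi_pos.ne' ?_ a b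
  have := h2.trans h1
  rwa [show -(Real.pi / 2) + Real.pi = Real.pi / 2 by ring]

theorem ae_sin_sub_ne_zero (α : ℝ) : ∀ᵐ θ : ℝ, Real.sin (θ - α) ≠ 0 := by
  have hc : ({θ : ℝ | Real.sin (θ - α) = 0} : Set ℝ).Countable := by
    refine (countable_range (fun n : ℤ ↦ (n : ℝ) * Real.pi + α)).mono fun θ hθ ↦ ?_
    obtain ⟨n, hn⟩ := Real.sin_eq_zero_iff.1 hθ
    exact ⟨n, by simp only [hn]; ring⟩
  exact (compl_mem_ae_iff.2 (hc.measure_zero volume))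

theorem mul_abs_sin_le_norm_circleMap_sub (r : ℝ) (hr : 0 ≤ r) (u : ℂ) (θ : ℝ) :
    r * |Real.sin (θ - u.arg)| ≤ ‖circleMap 0 r θ - u‖ := by
  have h1 : circleMap 0 r θ - u = (r * cexp ((θ - u.arg : ℝ) * I) - ‖u‖) * cexp (u.arg * I) := by
    conv_lhs => rw [← Complex.norm_mul_exp_arg_mul_I u]
    rw [circleMap_zero, sub_mul, mul_assoc, ← Complex.exp_add]
    congr 3
    push_cast; ring
  rw [h1, norm_mul, Complex.norm_exp_ofReal_mul_I, mul_one]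
  refine le_trans (le_of_eq ?_) (Complex.abs_im_le_norm _)
  rw [Complex.sub_im, Complex.ofReal_im, sub_zero, Complex.im_ofReal_mul, abs_mul,
    abs_of_nonneg hr, Complex.exp_ofReal_mul_I_im]

/-- The square root of a Cauchy kernel has uniformly bounded circle averages. -/
theorem exists_circleAverage_sqrt_norm_inv_sub_le :
    ∃ K : ℝ, 0 ≤ K ∧ ∀ r : ℝ, 1 ≤ r → ∀ u : ℂ,
      CircleIntegrable (fun z ↦ √‖(z - u)⁻¹‖) 0 r ∧
      Real.circleAverage (fun z ↦ √‖(z - u)⁻¹‖) 0 r ≤ K := by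
  set G : ℝ → ℝ := fun θ ↦ √(|Real.sin θ|⁻¹) with hG
  have hper : Function.Periodic G (2 * Real.pi) := fun θ ↦ by
    simp only [hG, Real.sin_add_two_pi]
  refine ⟨(2 * Real.pi)⁻¹ * ∫ θ in (0)..(2 * Real.pi), G θ, ?_, fun r hr u ↦ ?_⟩
  · exact mul_nonneg (by positivity)
      (intervalIntegral.integral_nonneg (by positivity) fun _ _ ↦ Real.sqrt_nonneg _)
  have hGi : IntervalIntegrable (fun θ ↦ G (θ - u.arg)) volume 0 (2 * Real.pi) := by
    have := (intervalIntegrable_sqrt_inv_abs_sin (0 - u.arg) (2 * Real.pi - u.arg)).comp_sub_right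
      u.arg
    rwa [sub_add_cancel, sub_add_cancel] at this
  have hle : ∀ᵐ θ : ℝ, √‖(circleMap 0 r θ - u)⁻¹‖ ≤ G (θ - u.arg) := by
    filter_upwards [ae_sin_sub_ne_zero u.arg] with θ hθ
    have hp : 0 < |Real.sin (θ - u.arg)| := abs_pos.2 hθ
    apply Real.sqrt_le_sqrt
    rw [norm_inv]
    refine inv_anti₀ hp (le_trans ?_ (mul_abs_sin_le_norm_circleMap_sub r (by linarith) u θ))
    exact le_mul_of_one_le_left hp.le hr
  have hint : CircleIntegrable (fun z ↦ √‖(z - u)⁻¹‖) 0 r := by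
    refine hGi.mono_fun' (Measurable.aestronglyMeasurable (by fun_prop)) ?_
    filter_upwards [ae_restrict_of_ae hle] with θ hθ
    rwa [Real.norm_of_nonneg (Real.sqrt_nonneg _)]
  refine ⟨hint, ?_⟩
  rw [Real.circleAverage_def, smul_eq_mul]
  gcongr
  refine (intervalIntegral.integral_mono_ae (by positivity) hint hGi hle).trans (le_of_eq ?_)
  rw [intervalIntegral.integral_comp_sub_right (fun θ ↦ G θ)]
  have := hper.intervalIntegral_add_eq (0 - u.arg) 0
  rw [zero_add] at this
  rw [← this]
  congr 1
  ring

theorem Real.sqrt_add_le_sqrt_add_sqrt {x y : ℝ} (hx : 0 ≤ x) (hy : 0 ≤ y) :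
    √(x + y) ≤ √x + √y := by
  simpa only [Real.sqrt_eq_rpow] using
    Real.rpow_add_le_add_rpow hx hy (by norm_num) (by norm_num)

theorem Real.sqrt_sum_le_sum_sqrt {ι : Type*} (s : Finset ι) (f : ι → ℝ)
    (hf : ∀ i ∈ s, 0 ≤ f i) : √(∑ i ∈ s, f i) ≤ ∑ i ∈ s, √(f i) := by
  refine Real.sqrt_le_iff.2 ⟨Finset.sum_nonneg fun _ _ ↦ Real.sqrt_nonneg _, ?_⟩
  calc ∑ i ∈ s, f i = ∑ i ∈ s, √(f i) ^ 2 :=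
        Finset.sum_congr rfl fun i hi ↦ (Real.sq_sqrt (hf i hi)).symm
    _ ≤ (∑ i ∈ s, √(f i)) ^ 2 := Finset.sum_sq_le_sq_sum_of_nonneg fun _ _ ↦ Real.sqrt_nonneg _

theorem posLog_le_of_sqrt_le {x y A : ℝ} (hx : 0 ≤ x) (hA : 0 ≤ A) (h : √x ≤ y) :
    Real.posLog x ≤ 2 * Real.log (1 + A) + 2 * y / (1 + A) := by
  have hy : 0 ≤ y := (Real.sqrt_nonneg x).trans h
  have h1 : x ≤ (1 + y) ^ 2 := by
    have : x = √x ^ 2 := (Real.sq_sqrt hx).symm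
    nlinarith [Real.sqrt_nonneg x]
  have h2 : Real.posLog x ≤ 2 * Real.log (1 + y) := by
    refine max_le_iff.2
      ⟨by have := Real.log_nonneg (show (1 : ℝ) ≤ 1 + y by linarith); linarith, ?_⟩
    rcases hx.eq_or_lt with rfl | hx'
    · have := Real.log_nonneg (show (1 : ℝ) ≤ 1 + y by linarith); simpa using this
    · calc Real.log x ≤ Real.log ((1 + y) ^ 2) := Real.log_le_log hx' h1
        _ = 2 * Real.log (1 + y) := by rw [Real.log_pow]; norm_num
  have h3 : Real.log (1 + y) ≤ Real.log (1 + A) + y / (1 + A) := by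
    have h4 := Real.log_le_sub_one_of_pos (show 0 < (1 + y) / (1 + A) by positivity)
    rw [Real.log_div (by positivity) (by positivity)] at h4
    have : (1 + y) / (1 + A) - 1 ≤ y / (1 + A) := by
      rw [sub_le_iff_le_add, ← sub_le_iff_le_add', ← sub_div, div_le_one (by positivity)]
      linarith
    linarith
  calc _ ≤ 2 * Real.log (1 + y) := h2
    _ ≤ 2 * (Real.log (1 + A) + y / (1 + A)) := by gcongr
    _ = _ := by ring

/-- A function dominated on a circle by a sum of Cauchy kernels plus a constant has small
proximity function. -/
theorem exists_circleAverage_posLog_le_of_le_sum_norm_inv_sub :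
    ∃ K : ℝ, 0 ≤ K ∧ ∀ (X : ℂ → ℂ) (r B : ℝ) (S : Finset ℂ) (d : ℂ → ℝ), 1 ≤ r → 0 ≤ B →
      (∀ u ∈ S, 1 ≤ d u) → CircleIntegrable (fun z ↦ Real.posLog ‖X z‖) 0 r →
      (∀ z ∈ Metric.sphere (0 : ℂ) |r|, ‖X z‖ ≤ ∑ u ∈ S, d u * ‖(z - u)⁻¹‖ + B) →
      Real.circleAverage (fun z ↦ Real.posLog ‖X z‖) 0 r ≤
        2 + 2 * Real.log (1 + (K * ∑ u ∈ S, d u + (1 + B))) := by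
  obtain ⟨K, hK0, hK⟩ := exists_circleAverage_sqrt_norm_inv_sub_le
  refine ⟨K, hK0, fun X r B S d hr hB hd hX hle ↦ ?_⟩
  set A : ℝ := K * ∑ u ∈ S, d u + (1 + B) with hAdef
  have hsum0 : 0 ≤ ∑ u ∈ S, d u := Finset.sum_nonneg fun u hu ↦ zero_le_one.trans (hd u hu)
  have hA : 0 ≤ A := by positivity
  set Y : ℂ → ℝ := fun z ↦ ∑ u ∈ S, d u * √‖(z - u)⁻¹‖ + (1 + B) with hY
  have hYS : CircleIntegrable (fun z ↦ ∑ u ∈ S, d u * √‖(z - u)⁻¹‖) 0 r :=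
    CircleIntegrable.fun_sum S fun u _ ↦ IntervalIntegrable.const_mul (hK r hr u).1 _
  have hYi : CircleIntegrable Y 0 r :=
    CircleIntegrable.add hYS (circleIntegrable_const _ _ _)
  have hYavg : Real.circleAverage Y 0 r ≤ A := by
    rw [hY, Real.circleAverage_fun_add hYS (circleIntegrable_const _ _ _),
      Real.circleAverage_const, Real.circleAverage_fun_sum
        (f := fun u z ↦ d u * √‖(z - u)⁻¹‖)
        (fun u _ ↦ IntervalIntegrable.const_mul (hK r hr u).1 _), hAdef, Finset.mul_sum]
    gcongr with u hu
    have : Real.circleAverage (fun z ↦ d u * √‖(z - u)⁻¹‖) 0 r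
        = d u * Real.circleAverage (fun z ↦ √‖(z - u)⁻¹‖) 0 r :=
      Real.circleAverage_fun_smul (a := d u) (f := fun z ↦ √‖(z - u)⁻¹‖)
    rw [this, mul_comm]
    exact mul_le_mul_of_nonneg_right (hK r hr u).2 (zero_le_one.trans (hd u hu))
  have hbi : CircleIntegrable (fun z ↦ 2 / (1 + A) * Y z) 0 r := IntervalIntegrable.const_mul hYi _
  have hmaj : CircleIntegrable (fun z ↦ 2 * Real.log (1 + A) + 2 / (1 + A) * Y z) 0 r :=
    CircleIntegrable.add (circleIntegrable_const _ _ _) hbi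
  refine (Real.circleAverage_mono hX hmaj fun z hz ↦ ?_).trans ?_
  · have hs : √‖X z‖ ≤ Y z := by
      calc √‖X z‖ ≤ √(∑ u ∈ S, d u * ‖(z - u)⁻¹‖ + B) := Real.sqrt_le_sqrt (hle z hz)
        _ ≤ √(∑ u ∈ S, d u * ‖(z - u)⁻¹‖) + √B := Real.sqrt_add_le_sqrt_add_sqrt
            (Finset.sum_nonneg fun u hu ↦ mul_nonneg (zero_le_one.trans (hd u hu)) (norm_nonneg _))
            hB
        _ ≤ ∑ u ∈ S, √(d u * ‖(z - u)⁻¹‖) + (1 + B) := by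
          gcongr
          · exact Real.sqrt_sum_le_sum_sqrt _ _ fun u hu ↦
              mul_nonneg (zero_le_one.trans (hd u hu)) (norm_nonneg _)
          · rw [Real.sqrt_le_iff]; constructor <;> nlinarith
        _ ≤ Y z := by
          simp only [hY]
          gcongr with u hu
          have h1 := hd u hu
          rw [Real.sqrt_mul (by linarith)]
          gcongr
          rw [Real.sqrt_le_iff]; constructor <;> nlinarith
    refine (posLog_le_of_sqrt_le (norm_nonneg _) hA hs).trans (le_of_eq ?_)
    ring
  · rw [Real.circleAverage_fun_add (circleIntegrable_const _ _ _) hbi, Real.circleAverage_const]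
    have : Real.circleAverage (fun z ↦ 2 / (1 + A) * Y z) 0 r
        = 2 / (1 + A) * Real.circleAverage Y 0 r :=
      Real.circleAverage_fun_smul (a := 2 / (1 + A)) (f := Y)
    rw [this]
    have h2 : 2 / (1 + A) * Real.circleAverage Y 0 r ≤ 2 := by
      calc _ ≤ 2 / (1 + A) * A := by gcongr
        _ ≤ 2 := by rw [div_mul_eq_mul_div, div_le_iff₀ (by positivity)]; linarith
    linarith

/-- Finitely many points contribute at most the full logarithmic counting function. -/
theorem sum_mul_log_sub_log_le_logCounting {D : Function.locallyFinsupp ℂ ℤ} (hD : 0 ≤ D)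
    (S : Finset ℂ) {R : ℝ} (hR : 1 ≤ R) (hS : ∀ u ∈ S, ‖u‖ ≤ R) :
    ∑ u ∈ S, (D u : ℝ) * (Real.log R - Real.log ‖u‖) ≤
      Function.locallyFinsuppWithin.logCounting D R := by
  have h1 : ∑ u ∈ S, Function.locallyFinsuppWithin.single u (D u) ≤ D := by
    intro z
    have : (∑ u ∈ S, Function.locallyFinsuppWithin.single u (D u)) z
        = ∑ u ∈ S, if z = u then D u else 0 := by
      rw [Function.locallyFinsuppWithin.coe_sum, Finset.sum_apply]
      simp only [Function.locallyFinsuppWithin.single_apply]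
    rw [this, Finset.sum_ite_eq]
    split_ifs
    · exact le_rfl
    · exact hD z
  have h2 := Function.locallyFinsuppWithin.logCounting_le h1 hR
  rw [map_sum, Finset.sum_apply] at h2
  refine le_trans (le_of_eq (Finset.sum_congr rfl fun u hu ↦ ?_)) h2
  rw [Function.locallyFinsuppWithin.logCounting_single_eq_log_sub_const (hS u hu)]

theorem eventually_codiscreteWithin_of_forall_nhdsNE {s : Set ℂ} {p : ℂ → Prop}
    (h : ∀ z ∈ s, ∀ᶠ w in 𝓝[≠] z, w ∈ s → p w) : ∀ᶠ w in codiscreteWithin s, p w := by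
  refine mem_codiscreteWithin_iff_forall_mem_nhdsNE.2 fun z hz ↦ ?_
  filter_upwards [h z hz] with w hw
  by_cases hws : w ∈ s
  · exact Or.inl (hw hws)
  · exact Or.inr hws

theorem eventually_nhdsNE_notMem_finset (S : Finset ℂ) (z : ℂ) : ∀ᶠ w in 𝓝[≠] z, w ∉ S := by
  have h : ∀ u ∈ S, ∀ᶠ w in 𝓝[≠] z, w ≠ u := fun u _ ↦ by
    by_cases hu : u = z
    · rw [hu]; exact eventually_mem_nhdsWithin
    · exact eventually_ne_nhdsWithin (Ne.symm hu)
  filter_upwards [(Filter.eventually_all_finset S).2 h] with w hw hwS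
  exact hw w hwS rfl

/-- Finitely many zeros and poles of a meromorphic function may be divided out. -/
theorem exists_factorization_of_finite_support {f : ℂ → ℂ} (hf : Meromorphic f)
    (hord : ∀ z, meromorphicOrderAt f z ≠ ⊤) {U : Set ℂ}
    (hfin : (MeromorphicOn.divisor f U).support.Finite) :
    ∃ (S : Finset ℂ) (g : ℂ → ℂ),
      (∀ u ∈ S, u ∈ U ∧ MeromorphicOn.divisor f univ u ≠ 0) ∧
      (∀ z ∈ U, AnalyticAt ℂ g z) ∧ (∀ z ∈ U, g z ≠ 0) ∧
      ∀ z ∈ U, ∀ᶠ w in 𝓝[≠] z, w ∈ U →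
        f w = (∏ u ∈ S, (w - u) ^ (MeromorphicOn.divisor f univ u)) * g w := by
  have hfU : MeromorphicOn f U := fun z _ ↦ hf z
  obtain ⟨g, hg, hg0, hfg⟩ := hfU.extract_zeros_poles (fun u ↦ hord u) hfin
  have hD : ∀ u ∈ U, MeromorphicOn.divisor f U u = MeromorphicOn.divisor f univ u :=
    fun u hu ↦ by
      rw [MeromorphicOn.divisor_apply hfU hu,
        MeromorphicOn.divisor_apply (fun z _ ↦ hf z) (mem_univ u)]
  have hSU : ∀ u ∈ hfin.toFinset, u ∈ U := fun u hu ↦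
    (MeromorphicOn.divisor f U).supportWithinDomain (hfin.mem_toFinset.1 hu)
  refine ⟨hfin.toFinset, g, fun u hu ↦ ⟨hSU u hu, ?_⟩, hg, fun z hz ↦ hg0 ⟨z, hz⟩,
    fun z hz ↦ ?_⟩
  · rw [← hD u (hSU u hu)]
    exact hfin.mem_toFinset.1 hu
  · have := mem_codiscreteWithin_iff_forall_mem_nhdsNE.1 hfg z hz
    filter_upwards [this] with w hw hwU
    rcases hw with hw | hw
    · have h1 : f w = ((∏ᶠ u, (fun x ↦ x - u) ^
        (MeromorphicOn.divisor f U) u) • g) w := hw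
      rw [h1, Function.FactorizedRational.finprod_eq_fun hfin, Pi.smul_apply', smul_eq_mul,
        finprod_eq_prod_of_mulSupport_subset (s := hfin.toFinset)]
      · congr 1
        exact Finset.prod_congr rfl fun u hu ↦ by rw [hD u (hSU u hu)]
      · intro u hu
        rw [Finset.mem_coe, hfin.mem_toFinset, Function.mem_support]
        intro h0
        exact hu (by simp only [h0, zpow_zero])
    · exact absurd hwU hw

/-- The zeros and poles of a meromorphic function in a closed disc may be divided out. -/
theorem exists_factorization_closedBall {f : ℂ → ℂ} (hf : Meromorphic f)
    (hord : ∀ z, meromorphicOrderAt f z ≠ ⊤) (ρ : ℝ) :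
    ∃ (S : Finset ℂ) (g : ℂ → ℂ),
      (∀ u ∈ S, ‖u‖ ≤ ρ ∧ MeromorphicOn.divisor f univ u ≠ 0) ∧
      (∀ z ∈ Metric.closedBall (0 : ℂ) ρ, AnalyticAt ℂ g z) ∧
      (∀ z ∈ Metric.closedBall (0 : ℂ) ρ, g z ≠ 0) ∧
      ∀ z ∈ Metric.closedBall (0 : ℂ) ρ, ∀ᶠ w in 𝓝[≠] z, w ∈ Metric.closedBall (0 : ℂ) ρ →
        f w = (∏ u ∈ S, (w - u) ^ (MeromorphicOn.divisor f univ u)) * g w := by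
  obtain ⟨S, g, hS, h⟩ := exists_factorization_of_finite_support hf hord
    ((MeromorphicOn.divisor f (Metric.closedBall (0 : ℂ) ρ)).finiteSupport
      (isCompact_closedBall 0 ρ))
  exact ⟨S, g, fun u hu ↦ ⟨by simpa using (hS u hu).1, (hS u hu).2⟩, h⟩

theorem circleAverage_mono_codiscreteWithin {f₁ f₂ : ℂ → ℝ} {c : ℂ} {R : ℝ}
    (h₁ : CircleIntegrable f₁ c R) (h₂ : CircleIntegrable f₂ c R) (hR : R ≠ 0)
    (h : ∀ᶠ z in codiscreteWithin (Metric.sphere c |R|), f₁ z ≤ f₂ z) :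
    Real.circleAverage f₁ c R ≤ Real.circleAverage f₂ c R := by
  have he : f₂ =ᶠ[codiscreteWithin (Metric.sphere c |R|)] fun z ↦ max (f₁ z) (f₂ z) :=
    h.mono fun z hz ↦ (max_eq_right hz).symm
  rw [Real.circleAverage_congr_codiscreteWithin he hR]
  exact Real.circleAverage_mono h₁ (h₂.congr_codiscreteWithin he) fun z _ ↦ le_max_left _ _

theorem abs_log_eq_two_mul_posLog_sub (x : ℝ) : |Real.log x| = 2 * Real.posLog x - Real.log x := by
  rw [← Real.half_mul_log_add_log_abs]; ring

theorem circleAverage_abs_log_norm_sub_le {u : ℂ} {ρ : ℝ} (hρ : 1 ≤ ρ) (hu : ‖u‖ ≤ ρ) :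
    CircleIntegrable (fun z ↦ |Real.log ‖z - u‖|) 0 ρ ∧
    Real.circleAverage (fun z ↦ |Real.log ‖z - u‖|) 0 ρ ≤ 2 * Real.log (2 * ρ) := by
  have hm : MeromorphicOn (fun z : ℂ ↦ z - u) (Metric.sphere (0 : ℂ) |ρ|) := fun z _ ↦ by fun_prop
  have h1 := hm.circleIntegrable_log_norm
  have h2 := hm.circleIntegrable_posLog_norm
  have hi : CircleIntegrable (fun z ↦ |Real.log ‖z - u‖|) 0 ρ := h1.abs
  refine ⟨hi, ?_⟩
  have hlog : 0 ≤ Real.log ρ := Real.log_nonneg hρ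
  have h3 := circleAverage_log_norm_sub_const_of_mem_closedBall (a := u) (c := 0) (R := ρ)
    (by simpa [abs_of_nonneg (zero_le_one.trans hρ)] using hu)
  have h4 : Real.circleAverage (fun z ↦ |Real.log ‖z - u‖| + Real.log ‖z - u‖) 0 ρ
      ≤ 2 * Real.log (2 * ρ) := by
    rw [← Real.circleAverage_const (2 * Real.log (2 * ρ)) (0 : ℂ) ρ]
    refine Real.circleAverage_mono (hi.add h1) (circleIntegrable_const _ _ _) fun z hz ↦ ?_
    have hz' : ‖z‖ = ρ := by simpa [abs_of_nonneg (zero_le_one.trans hρ)] using hz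
    rw [abs_log_eq_two_mul_posLog_sub, sub_add_cancel]
    gcongr
    refine max_le (Real.log_nonneg (by linarith)) ?_
    rcases (norm_nonneg (z - u)).eq_or_lt with h0 | h0
    · rw [← h0, Real.log_zero]; exact Real.log_nonneg (by linarith)
    · exact Real.log_le_log h0 ((norm_sub_le z u).trans (by linarith))
  rw [Real.circleAverage_fun_add hi h1, h3] at h4
  linarith

/-- Dividing out finitely many zeros and poles in the disc changes the mean of `|log ‖f‖|` by a
controlled amount. -/
theorem circleAverage_abs_log_norm_le_of_factorization {f g : ℂ → ℂ} {S : Finset ℂ} {d : ℂ → ℤ}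
    {ρ : ℝ} (hρ : 1 ≤ ρ) (hf : Meromorphic f) (hS : ∀ u ∈ S, ‖u‖ ≤ ρ)
    (hg : ∀ z ∈ Metric.closedBall (0 : ℂ) ρ, AnalyticAt ℂ g z)
    (hg0 : ∀ z ∈ Metric.closedBall (0 : ℂ) ρ, g z ≠ 0)
    (hfg : ∀ z ∈ Metric.closedBall (0 : ℂ) ρ, ∀ᶠ w in 𝓝[≠] z, w ∈ Metric.closedBall (0 : ℂ) ρ →
        f w = (∏ u ∈ S, (w - u) ^ d u) * g w) :
    Real.circleAverage (fun z ↦ |Real.log ‖g z‖|) 0 ρ ≤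
      Real.circleAverage (fun z ↦ |Real.log ‖f z‖|) 0 ρ +
        (∑ u ∈ S, |(d u : ℝ)|) * (2 * Real.log (2 * ρ)) := by
  have hρ0 : 0 < ρ := by linarith
  have hsub : Metric.sphere (0 : ℂ) |ρ| ⊆ Metric.closedBall (0 : ℂ) ρ := by
    rw [abs_of_pos hρ0]; exact Metric.sphere_subset_closedBall
  have hfi : CircleIntegrable (fun z ↦ |Real.log ‖f z‖|) 0 ρ :=
    (MeromorphicOn.circleIntegrable_log_norm fun z _ ↦ hf z).abs
  have hsi : CircleIntegrable (fun z ↦ ∑ u ∈ S, |(d u : ℝ)| * |Real.log ‖z - u‖|) 0 ρ := by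
    exact CircleIntegrable.fun_sum S fun u hu ↦
      IntervalIntegrable.const_mul (circleAverage_abs_log_norm_sub_le hρ (hS u hu)).1 _
  have hgi : CircleIntegrable (fun z ↦ |Real.log ‖g z‖|) 0 ρ :=
    (MeromorphicOn.circleIntegrable_log_norm fun z hz ↦ (hg z (hsub hz)).meromorphicAt).abs
  refine (circleAverage_mono_codiscreteWithin hgi (hfi.add hsi) hρ0.ne' ?_).trans ?_
  · refine eventually_codiscreteWithin_of_forall_nhdsNE fun z hz ↦ ?_
    filter_upwards [hfg z (hsub hz), eventually_nhdsNE_notMem_finset S z] with w hw hwS hws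
    have hne : ∀ u ∈ S, ‖(w - u) ^ d u‖ ≠ 0 := fun u hu ↦
      norm_ne_zero_iff.2 (zpow_ne_zero _ (sub_ne_zero.2 fun h ↦ hwS (h ▸ hu)))
    have h1 : Real.log ‖f w‖ = ∑ u ∈ S, (d u : ℝ) * Real.log ‖w - u‖ + Real.log ‖g w‖ := by
      rw [hw (hsub hws), norm_mul, norm_prod, Real.log_mul (Finset.prod_ne_zero_iff.2 hne)
        (norm_ne_zero_iff.2 (hg0 w (hsub hws))), Real.log_prod hne]
      congr 1
      exact Finset.sum_congr rfl fun u _ ↦ by rw [norm_zpow, Real.log_zpow]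
    have h2 : Real.log ‖g w‖ = Real.log ‖f w‖ - ∑ u ∈ S, (d u : ℝ) * Real.log ‖w - u‖ := by
      rw [h1]; ring
    simp only [Pi.add_apply]
    rw [h2]
    refine (abs_sub _ _).trans ?_
    gcongr
    refine (Finset.abs_sum_le_sum_abs _ _).trans (le_of_eq ?_)
    exact Finset.sum_congr rfl fun u _ ↦ abs_mul _ _
  · have h3 : Real.circleAverage (fun z ↦ ∑ u ∈ S, |(d u : ℝ)| * |Real.log ‖z - u‖|) 0 ρ
        ≤ (∑ u ∈ S, |(d u : ℝ)|) * (2 * Real.log (2 * ρ)) := by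
      rw [Real.circleAverage_fun_sum (f := fun u z ↦ |(d u : ℝ)| * |Real.log ‖z - u‖|)
        (fun u hu ↦ IntervalIntegrable.const_mul
          (circleAverage_abs_log_norm_sub_le hρ (hS u hu)).1 _), Finset.sum_mul]
      refine Finset.sum_le_sum fun u hu ↦ ?_
      have : Real.circleAverage (fun z ↦ |(d u : ℝ)| * |Real.log ‖z - u‖|) 0 ρ
          = |(d u : ℝ)| * Real.circleAverage (fun z ↦ |Real.log ‖z - u‖|) 0 ρ :=
        Real.circleAverage_fun_smul (a := |(d u : ℝ)|) (f := fun z ↦ |Real.log ‖z - u‖|)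
      rw [this]
      exact mul_le_mul_of_nonneg_left (circleAverage_abs_log_norm_sub_le hρ (hS u hu)).2
        (abs_nonneg _)
    rw [Real.circleAverage_add hfi hsi]
    linarith

/-- The mean of `|log ‖f‖|` is at most twice the characteristic, up to a constant. -/
theorem exists_circleAverage_abs_log_norm_le_characteristic {f : ℂ → ℂ} (hf : Meromorphic f) :
    ∃ c : ℝ, 0 ≤ c ∧ ∀ r : ℝ, 1 ≤ r → Real.circleAverage (fun z ↦ |Real.log ‖f z‖|) 0 r ≤
      2 * ValueDistribution.characteristic f ⊤ r + c := by
  refine ⟨_, (abs_nonneg _).trans (le_max_left |Real.log ‖f 0‖|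
    |Real.log ‖meromorphicTrailingCoeffAt f 0‖|), fun r hr ↦ ?_⟩
  have h1 := ValueDistribution.characteristic_sub_characteristic_inv_le (R := r) hf
  have h2 : Real.circleAverage (fun z ↦ |Real.log ‖f z‖|) 0 r
      = ValueDistribution.proximity f ⊤ r + ValueDistribution.proximity f⁻¹ ⊤ r := by
    rw [ValueDistribution.proximity_top, ValueDistribution.proximity_top,
      ← Real.circleAverage_add (MeromorphicOn.circleIntegrable_posLog_norm fun z _ ↦ hf z)
        (MeromorphicOn.circleIntegrable_posLog_norm fun z _ ↦ (hf z).inv)]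
    congr 1
    ext z
    rw [abs_log_eq_two_mul_posLog_sub, ← Real.posLog_sub_posLog_inv, Pi.add_apply, Pi.inv_apply,
      norm_inv]
    ring
  have h3 := ValueDistribution.logCounting_nonneg (f := f) (e := ⊤) hr
  have h4 := ValueDistribution.logCounting_nonneg (f := f⁻¹) (e := ⊤) hr
  have h5 : ValueDistribution.characteristic f ⊤ r = ValueDistribution.proximity f ⊤ r
    + ValueDistribution.logCounting f ⊤ r := rfl
  have h6 : ValueDistribution.characteristic f⁻¹ ⊤ r = ValueDistribution.proximity f⁻¹ ⊤ r
    + ValueDistribution.logCounting f⁻¹ ⊤ r := rfl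
  have h7 := (abs_le.1 h1).1
  linarith

/-- Up to a constant, the counting function of zeros and poles is at most twice the
characteristic. -/
theorem exists_sum_abs_divisor_mul_log_le {f : ℂ → ℂ} (hf : Meromorphic f) :
    ∃ c : ℝ, 0 ≤ c ∧ ∀ (R : ℝ) (S : Finset ℂ), 1 ≤ R → (∀ u ∈ S, ‖u‖ ≤ R) →
      ∑ u ∈ S, (|MeromorphicOn.divisor f univ u| : ℝ) * (Real.log R - Real.log ‖u‖) ≤
        2 * ValueDistribution.characteristic f ⊤ R + c := by
  refine ⟨_, (abs_nonneg _).trans (le_max_left |Real.log ‖f 0‖|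
    |Real.log ‖meromorphicTrailingCoeffAt f 0‖|), fun R S hR hS ↦ ?_⟩
  have h1 := ValueDistribution.characteristic_sub_characteristic_inv_le (R := R) hf
  set D := MeromorphicOn.divisor f univ with hD
  have h2 := sum_mul_log_sub_log_le_logCounting (posPart_nonneg D) S hR hS
  have h3 := sum_mul_log_sub_log_le_logCounting (negPart_nonneg D) S hR hS
  have h4 : ∑ u ∈ S, (|D u| : ℝ) * (Real.log R - Real.log ‖u‖) =
      ∑ u ∈ S, ((D⁺ u : ℤ) : ℝ) * (Real.log R - Real.log ‖u‖) +
      ∑ u ∈ S, ((D⁻ u : ℤ) : ℝ) * (Real.log R - Real.log ‖u‖) := by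
    rw [← Finset.sum_add_distrib]
    refine Finset.sum_congr rfl fun u _ ↦ ?_
    rw [← add_mul, Function.locallyFinsuppWithin.posPart_apply,
      Function.locallyFinsuppWithin.negPart_apply, ← Int.cast_add, posPart_add_negPart,
      Int.cast_abs]
  rw [← ValueDistribution.logCounting_zero, ← ValueDistribution.logCounting_inv] at h2
  rw [← ValueDistribution.logCounting_top] at h3
  have h5 : ValueDistribution.characteristic f ⊤ R = ValueDistribution.proximity f ⊤ R
    + ValueDistribution.logCounting f ⊤ R := rfl
  have h6 : ValueDistribution.characteristic f⁻¹ ⊤ R = ValueDistribution.proximity f⁻¹ ⊤ R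
    + ValueDistribution.logCounting f⁻¹ ⊤ R := rfl
  have h7 := (abs_le.1 h1).1
  have h8 : 0 ≤ ValueDistribution.proximity f ⊤ R := ValueDistribution.proximity_nonneg R
  have h9 : 0 ≤ ValueDistribution.proximity f⁻¹ ⊤ R := ValueDistribution.proximity_nonneg R
  linarith

theorem logDeriv_eventuallyEq_of_factorization {f g : ℂ → ℂ} {S : Finset ℂ} {d : ℂ → ℤ} {z : ℂ}
    (hg : AnalyticAt ℂ g z) (hg0 : g z ≠ 0)
    (hfg : ∀ᶠ w in 𝓝[≠] z, f w = (∏ u ∈ S, (w - u) ^ d u) * g w) :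
    ∀ᶠ w in 𝓝[≠] z, logDeriv f w = ∑ u ∈ S, (d u : ℂ) * (w - u)⁻¹ + logDeriv g w := by
  have hfg' : f =ᶠ[𝓝[≠] z] fun w ↦ (∏ u ∈ S, (w - u) ^ d u) * g w := hfg
  filter_upwards [hfg, hfg'.nhdsNE_deriv, eventually_nhdsNE_notMem_finset S z,
    nhdsWithin_le_nhds hg.eventually_analyticAt,
    nhdsWithin_le_nhds (hg.continuousAt.eventually_ne hg0)] with w h1 h2 hwS h3 h4
  have hne : ∀ u ∈ S, (w - u) ^ d u ≠ 0 := fun u hu ↦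
    zpow_ne_zero _ (sub_ne_zero.2 fun h ↦ hwS (h ▸ hu))
  have hd : ∀ u ∈ S, DifferentiableAt ℂ (fun w ↦ (w - u) ^ d u) w := fun u hu ↦
    (differentiableAt_id.sub_const u).zpow (Or.inl (sub_ne_zero.2 fun h : w = u ↦ hwS (h ▸ hu)))
  have h5 : logDeriv f w = logDeriv (fun w ↦ (∏ u ∈ S, (w - u) ^ d u) * g w) w := by
    rw [logDeriv_apply, logDeriv_apply, h1, h2]
  rw [h5, logDeriv_mul w (Finset.prod_ne_zero_iff.2 hne) h4
    (DifferentiableAt.fun_finsetProd hd) h3.differentiableAt]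
  congr 1
  have h6 := logDeriv_prod (s := S) (f := fun u w ↦ (w - u) ^ d u) (x := w) hne hd
  rw [h6]
  refine Finset.sum_congr rfl fun u hu ↦ ?_
  rw [logDeriv_fun_zpow (f := fun w ↦ w - u) (differentiableAt_id.sub_const u), logDeriv_apply,
    deriv_sub_const, deriv_id'', one_div]

/-- The numerical estimate behind the lemma on the logarithmic derivative. -/
theorem le_mul_one_add_log_of_bounds {K c₁ c₂ r R T N V B : ℝ} (hK : 0 ≤ K) (hc₁ : 0 ≤ c₁)
    (hc₂ : 0 ≤ c₂) (hr : 1 ≤ r) (hrR : r < R) (hT : 0 ≤ T) (hN : 0 ≤ N)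
    (hNT : N * (Real.log R - Real.log ((r + R) / 2)) ≤ 2 * T + c₂)
    (hV : V ≤ 2 * T + c₁ + N * (2 * Real.log (2 * ((r + R) / 2))))
    (hB : B = 2 * ((r + R) / 2) / ((r + R) / 2 - r) ^ 2 * V) (hV0 : 0 ≤ V) (hB0 : 0 ≤ B) :
    2 + 2 * Real.log (1 + (K * N + (1 + B))) ≤
      (16 + 2 * Real.log (2 + (2 + c₁ + c₂) * (2 * K + 72))) *
        (1 + Real.log (R + 1 / (R - r) + T)) := by
  have hδ : 0 < R - r := by linarith
  set W := R + 1 / (R - r) + T with hW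
  set a := 2 + c₁ + c₂ with ha
  have hδ' : 0 < 1 / (R - r) := by positivity
  have hR0 : 0 < R := by linarith
  have hW1 : 1 ≤ W := by linarith
  have hRW : R ≤ W := by linarith
  have hδW : 1 / (R - r) ≤ W := by linarith
  have hTW : T ≤ W := by linarith
  have hdW : ∀ c, 0 ≤ c → 2 + c ≤ a → 2 * T + c ≤ a * W := fun c hc hca ↦ by nlinarith
  have hlog : (R - r) / (2 * R) ≤ Real.log R - Real.log ((r + R) / 2) := by
    rw [← Real.log_div hR0.ne' (by linarith)]
    refine le_trans ?_ (Real.one_sub_inv_le_log_of_pos (by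
      have : 0 < (r + R) / 2 := by linarith
      positivity))
    rw [inv_div]
    apply le_of_eq
    field_simp
    ring
  have ha0 : 0 ≤ a := by linarith
  have hN1 : N ≤ 2 * a * W ^ 3 := by
    have h1 : N * ((R - r) / (2 * R)) ≤ a * W :=
      (mul_le_mul_of_nonneg_left hlog hN).trans (hNT.trans (hdW c₂ hc₂ (by linarith)))
    have h2 : N = N * ((R - r) / (2 * R)) * (2 * R * (1 / (R - r))) := by field_simp
    rw [h2]
    calc _ ≤ (a * W) * (2 * W * W) := by gcongr
      _ = _ := by ring
  have hl2 : Real.log (2 * ((r + R) / 2)) ≤ 2 * W := by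
    refine (Real.log_le_sub_one_of_pos (by linarith)).trans (by linarith)
  have hV1 : V ≤ 9 * a * W ^ 4 := by
    have h1 : N * (2 * Real.log (2 * ((r + R) / 2))) ≤ 2 * a * W ^ 3 * (2 * (2 * W)) := by
      gcongr
      exact mul_nonneg zero_le_two (Real.log_nonneg (by linarith))
    have h2 : a * W ≤ a * W ^ 4 := by gcongr; exact le_self_pow₀ hW1 (by norm_num)
    have h3 := hdW c₁ hc₁ (by linarith)
    have h4 : 2 * a * W ^ 3 * (2 * (2 * W)) = 8 * (a * W ^ 4) := by ring
    linarith
  have hB1 : B ≤ 72 * a * W ^ 7 := by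
    have h1 : 2 * ((r + R) / 2) / ((r + R) / 2 - r) ^ 2 = 4 * (r + R) * (1 / (R - r)) ^ 2 := by
      have : (r + R) / 2 - r = (R - r) / 2 := by ring
      rw [this]; field_simp; ring
    rw [hB, h1]
    calc _ ≤ 4 * (W + W) * W ^ 2 * (9 * a * W ^ 4) := by
          gcongr
          linarith
      _ = _ := by ring
  set A := 2 + a * (2 * K + 72) with hA
  have hA1 : 1 ≤ A := by have : 0 ≤ a * (2 * K + 72) := by positivity
                         linarith
  have h3 : 1 + (K * N + (1 + B)) ≤ A * W ^ 7 := by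
    have h4 : K * N ≤ K * (2 * a * W ^ 3) := by gcongr
    have h5 : K * (2 * a * W ^ 3) ≤ K * (2 * a * W ^ 7) := by
      have : W ^ 3 ≤ W ^ 7 := pow_le_pow_right₀ hW1 (by norm_num)
      exact mul_le_mul_of_nonneg_left (mul_le_mul_of_nonneg_left this (by linarith)) hK
    have h6 : 1 ≤ W ^ 7 := one_le_pow₀ hW1
    have h8 : A * W ^ 7 = 2 * W ^ 7 + K * (2 * a * W ^ 7) + 72 * a * W ^ 7 := by rw [hA]; ring
    linarith
  have h7 : Real.log (1 + (K * N + (1 + B))) ≤ Real.log A + 7 * Real.log W := by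
    refine (Real.log_le_log (by linarith [mul_nonneg hK hN]) h3).trans (le_of_eq ?_)
    rw [Real.log_mul (by linarith) (by positivity), Real.log_pow]
    norm_num
  have h8 : 0 ≤ Real.log A := Real.log_nonneg hA1
  have h9 : 0 ≤ Real.log W := Real.log_nonneg hW1
  have h10 : (16 + 2 * Real.log A) * (1 + Real.log W) =
    16 + 16 * Real.log W + 2 * Real.log A + 2 * (Real.log A * Real.log W) := by ring
  rw [h10]
  linarith [mul_nonneg h8 h9]

/-- **Lemma on the logarithmic derivative**, with two radii. -/
theorem exists_proximity_logDeriv_le {f : ℂ → ℂ} (hf : Meromorphic f)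
    (hord : ∀ z, meromorphicOrderAt f z ≠ ⊤) :
    ∃ C : ℝ, 0 ≤ C ∧ ∀ r R : ℝ, 1 ≤ r → r < R →
      ValueDistribution.proximity (logDeriv f) ⊤ r ≤
        C * (1 + Real.log (R + 1 / (R - r) + ValueDistribution.characteristic f ⊤ R)) := by
  obtain ⟨K, hK, hprox⟩ := exists_circleAverage_posLog_le_of_le_sum_norm_inv_sub
  obtain ⟨c₁, hc₁, havg⟩ := exists_circleAverage_abs_log_norm_le_characteristic hf
  obtain ⟨c₂, hc₂, hsum⟩ := exists_sum_abs_divisor_mul_log_le hf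
  refine ⟨16 + 2 * Real.log (2 + (2 + c₁ + c₂) * (2 * K + 72)), ?_, fun r R hr hrR ↦ ?_⟩
  · have : 0 ≤ Real.log (2 + (2 + c₁ + c₂) * (2 * K + 72)) := Real.log_nonneg (by
      have : 0 ≤ (2 + c₁ + c₂) * (2 * K + 72) := by positivity
      linarith)
    linarith
  set ρ := (r + R) / 2 with hρ
  have hrρ : r < ρ := by rw [hρ]; linarith
  have hρR : ρ < R := by rw [hρ]; linarith
  have hρ1 : 1 ≤ ρ := by linarith
  obtain ⟨S, g, hS, hg, hg0, hfg⟩ := exists_factorization_closedBall hf hord ρ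
  set d := MeromorphicOn.divisor f univ with hd
  set V := Real.circleAverage (fun w ↦ |Real.log ‖g w‖|) 0 ρ with hV
  set B := 2 * ρ / (ρ - r) ^ 2 * V with hB
  set N := ∑ u ∈ S, (|d u| : ℝ) with hN
  have hV0 : 0 ≤ V := by
    rw [hV, Real.circleAverage_def]
    exact mul_nonneg (by positivity)
      (intervalIntegral.integral_nonneg Real.two_pi_pos.le fun _ _ ↦ abs_nonneg _)
  have hB0 : 0 ≤ B := mul_nonneg (by positivity) hV0
  have hT0 : 0 ≤ ValueDistribution.characteristic f ⊤ R :=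
    ValueDistribution.characteristic_nonneg (by linarith)
  have hTρ : ValueDistribution.characteristic f ⊤ ρ ≤ ValueDistribution.characteristic f ⊤ R :=
    ValueDistribution.characteristic_monotoneOn hf (by simp; linarith) (by simp; linarith) hρR.le
  have hVT : V ≤ 2 * ValueDistribution.characteristic f ⊤ R + c₁ + N * (2 * Real.log (2 * ρ)) := by
    have h1 := circleAverage_abs_log_norm_le_of_factorization hρ1 hf (fun u hu ↦ (hS u hu).1)
      hg hg0 hfg
    have h2 := havg ρ hρ1
    linarith
  have hN0 : 0 ≤ N := Finset.sum_nonneg fun _ _ ↦ abs_nonneg _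
  have hNT : N * (Real.log R - Real.log ρ) ≤
      2 * ValueDistribution.characteristic f ⊤ R + c₂ := by
    refine le_trans ?_ (hsum R S (by linarith) fun u hu ↦ (hS u hu).1.trans hρR.le)
    rw [hN, Finset.sum_mul]
    refine Finset.sum_le_sum fun u hu ↦ mul_le_mul_of_nonneg_left ?_ (abs_nonneg _)
    have : Real.log ‖u‖ ≤ Real.log ρ := by
      rcases (norm_nonneg u).eq_or_lt with h0 | h0
      · rw [← h0, Real.log_zero]; exact Real.log_nonneg hρ1
      · exact Real.log_le_log h0 (hS u hu).1
    linarith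
  refine le_trans ?_ (le_mul_one_add_log_of_bounds hK hc₁ hc₂ hr hrR hT0 hN0 hNT hVT hB hV0 hB0)
  have hsub : Metric.sphere (0 : ℂ) |r| ⊆ Metric.ball (0 : ℂ) ρ := by
    rw [abs_of_pos (by linarith)]
    intro z hz
    simp only [mem_sphere_iff_norm, sub_zero] at hz
    simpa [hz] using hrρ
  set X : ℂ → ℂ := fun w ↦ ∑ u ∈ S, (d u : ℂ) * (w - u)⁻¹ + logDeriv g w with hX
  have hcongr : (fun z ↦ Real.posLog ‖logDeriv f z‖)
      =ᶠ[codiscreteWithin (Metric.sphere (0 : ℂ) |r|)] fun z ↦ Real.posLog ‖X z‖ := by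
    refine eventually_codiscreteWithin_of_forall_nhdsNE fun z hz ↦ ?_
    have hz' := Metric.ball_subset_closedBall (hsub hz)
    have h1 : ∀ᶠ w in 𝓝[≠] z, f w = (∏ u ∈ S, (w - u) ^ d u) * g w := by
      filter_upwards [hfg z hz', nhdsWithin_le_nhds (Metric.isOpen_ball.mem_nhds (hsub hz))]
        with w hw hwb using hw (Metric.ball_subset_closedBall hwb)
    filter_upwards [logDeriv_eventuallyEq_of_factorization (hg z hz') (hg0 z hz') h1]
      with w hw _
    rw [hw]
  have hint : CircleIntegrable (fun z ↦ Real.posLog ‖logDeriv f z‖) 0 r :=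
    MeromorphicOn.circleIntegrable_posLog_norm (fun z _ ↦ hf.logDeriv z)
  rw [ValueDistribution.proximity_top,
    Real.circleAverage_congr_codiscreteWithin hcongr (by linarith)]
  have hd1 : ∀ u ∈ S, (1 : ℝ) ≤ |(d u : ℝ)| := fun u hu ↦ by
    exact_mod_cast Int.one_le_abs (hS u hu).2
  refine hprox X r B S (fun u ↦ |(d u : ℝ)|) hr hB0 hd1 (hint.congr_codiscreteWithin hcongr)
    fun z hz ↦ ?_
  have hzr : ‖z‖ = r := by
    simpa [abs_of_pos (show 0 < r by linarith)] using hz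
  refine (norm_add_le _ _).trans (add_le_add ((norm_sum_le _ _).trans (le_of_eq ?_)) ?_)
  · exact Finset.sum_congr rfl fun u _ ↦ by rw [norm_mul, Complex.norm_intCast]
  · simpa [hzr] using norm_logDeriv_le_circleAverage hg hg0 (z := z) (by rwa [hzr])

/-- A monotone function cannot more than double at every step of length `1 / φ r`. -/
theorem exists_apply_add_inv_le_two_mul {φ : ℝ → ℝ} (hφ : MonotoneOn φ (Ici 1))
    (h1 : ∀ r, 1 ≤ r → 1 ≤ φ r) (r₀ : ℝ) : ∃ r, r₀ ≤ r ∧ 1 ≤ r ∧ φ (r + 1 / φ r) ≤ 2 * φ r := by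
  by_contra! hcon
  let a : ℕ → ℝ := Nat.rec (max r₀ 1) fun _ x ↦ x + 1 / φ x
  have ha0 : a 0 = max r₀ 1 := rfl
  have ha : ∀ n, a (n + 1) = a n + 1 / φ (a n) := fun _ ↦ rfl
  have key : ∀ n, max r₀ 1 ≤ a n ∧ (2 : ℝ) ^ n ≤ φ (a n) ∧
      a n ≤ max r₀ 1 + 2 - 2 * (1 / 2) ^ n := by
    intro n
    induction n with
    | zero => exact ⟨ha0.ge, by simpa using h1 _ (ha0 ▸ le_max_right _ _), by rw [ha0]; simp⟩
    | succ n ih =>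
      obtain ⟨h2, h3, h4⟩ := ih
      have h5 : (0 : ℝ) < 2 ^ n := by positivity
      have h6 : 1 / φ (a n) ≤ (1 / 2) ^ n := by
        rw [one_div_pow]; exact one_div_le_one_div_of_le h5 h3
      have h7 : 0 ≤ 1 / φ (a n) := by have := h5.trans_le h3; positivity
      have h8 := hcon (a n) ((le_max_left _ _).trans h2) ((le_max_right _ _).trans h2)
      rw [ha]
      refine ⟨by linarith, by rw [pow_succ]; linarith, ?_⟩
      rw [pow_succ]
      linarith
  have hM : (1 : ℝ) ≤ max r₀ 1 := le_max_right _ _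
  obtain ⟨n, hn⟩ := pow_unbounded_of_one_lt (φ (max r₀ 1 + 2)) one_lt_two
  obtain ⟨h2, h3, h4⟩ := key n
  have h5 : (0 : ℝ) < (1 / 2) ^ n := by positivity
  have := hφ (mem_Ici.2 (hM.trans h2)) (mem_Ici.2 (by linarith))
    (show a n ≤ max r₀ 1 + 2 by linarith)
  linarith

/-- For finitely many meromorphic functions there are arbitrarily large radii at which all the
logarithmic derivatives have small proximity functions. -/
theorem exists_proximity_logDeriv_le_mul_sum {ι : Type*} {s : Finset ι} {f : ι → ℂ → ℂ}
    (hf : ∀ i ∈ s, Meromorphic (f i)) (hord : ∀ i ∈ s, ∀ z, meromorphicOrderAt (f i) z ≠ ⊤)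
    {ε : ℝ} (hε : 0 < ε) :
    ∃ C : ℝ, 0 ≤ C ∧ ∀ r₀ : ℝ, ∃ r, r₀ ≤ r ∧ 1 ≤ r ∧ ∀ i ∈ s,
      ValueDistribution.proximity (logDeriv (f i)) ⊤ r ≤
        ε * ∑ j ∈ s, ValueDistribution.characteristic (f j) ⊤ r + C * (1 + Real.log r) := by
  have hex : ∀ i : ι, ∃ C : ℝ, 0 ≤ C ∧ (i ∈ s → ∀ r R : ℝ, 1 ≤ r → r < R →
      ValueDistribution.proximity (logDeriv (f i)) ⊤ r ≤
        C * (1 + Real.log (R + 1 / (R - r) + ValueDistribution.characteristic (f i) ⊤ R))) := by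
    intro i
    by_cases hi : i ∈ s
    · obtain ⟨C, hC, h⟩ := exists_proximity_logDeriv_le (hf i hi) (hord i hi)
      exact ⟨C, hC, fun _ ↦ h⟩
    · exact ⟨0, le_rfl, fun h ↦ absurd h hi⟩
  choose c hc hcle using hex
  set C := ∑ i ∈ s, c i with hCdef
  have hC : 0 ≤ C := Finset.sum_nonneg fun i _ ↦ hc i
  set η := ε / (C + 1) with hη
  have hη0 : 0 < η := by positivity
  have hCη : C * η ≤ ε := by
    rw [hη, ← mul_div_assoc, div_le_iff₀ (by linarith)]; nlinarith
  have hl3 : 0 ≤ Real.log 3 := Real.log_nonneg (by norm_num)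
  have hC2 : 0 ≤ C * (1 + Real.log 3) + ε + C * |Real.log η| := by positivity
  refine ⟨C * (1 + Real.log 3) + ε + C * |Real.log η| + C, by positivity, fun r₀ ↦ ?_⟩
  have hTnn : ∀ j r, 1 ≤ r → 0 ≤ ValueDistribution.characteristic (f j) ⊤ r := fun j r hr ↦
    ValueDistribution.characteristic_nonneg hr
  set A : ℝ → ℝ := fun r ↦ ∑ j ∈ s, ValueDistribution.characteristic (f j) ⊤ r with hS
  have hS0 : ∀ r, 1 ≤ r → 0 ≤ A r := fun r hr ↦ Finset.sum_nonneg fun j _ ↦ hTnn j r hr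
  obtain ⟨r, hr0, hr1, hr⟩ := exists_apply_add_inv_le_two_mul (φ := fun r ↦ r + A r)
    (fun x hx y hy hxy ↦ add_le_add hxy (Finset.sum_le_sum fun j hj ↦
      ValueDistribution.characteristic_monotoneOn (hf j hj) (mem_Ioi.2 (zero_lt_one.trans_le hx))
        (mem_Ioi.2 (zero_lt_one.trans_le hy)) hxy))
    (fun r hr ↦ by linarith [hS0 r hr]) r₀
  refine ⟨r, hr0, hr1, fun i hi ↦ ?_⟩
  set R := r + 1 / (r + A r) with hR
  have hφ : 1 ≤ r + A r := by linarith [hS0 r hr1]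
  have hrR : r < R := by rw [hR]; have : 0 < 1 / (r + A r) := by positivity
                         linarith
  have hR1 : 1 / (R - r) = r + A r := by rw [hR]; field_simp; ring
  have hTi : ValueDistribution.characteristic (f i) ⊤ R ≤ A R :=
    Finset.single_le_sum (f := fun j ↦ ValueDistribution.characteristic (f j) ⊤ R)
      (fun j _ ↦ hTnn j R (hr1.trans hrR.le)) hi
  have hW : R + 1 / (R - r) + ValueDistribution.characteristic (f i) ⊤ R ≤
      3 * (r * (1 + A r)) := by
    rw [hR1]; nlinarith [hS0 r hr1]
  have hW0 : 1 ≤ R + 1 / (R - r) + ValueDistribution.characteristic (f i) ⊤ R := by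
    rw [hR1]; linarith [hTnn i R (hr1.trans hrR.le)]
  have hlog : Real.log (R + 1 / (R - r) + ValueDistribution.characteristic (f i) ⊤ R) ≤
      Real.log 3 + Real.log r + Real.log (1 + A r) := by
    have := hS0 r hr1
    refine (Real.log_le_log (by linarith) hW).trans (le_of_eq ?_)
    rw [Real.log_mul (by norm_num) (by positivity), Real.log_mul (by positivity) (by positivity)]
    ring
  have hlogη : Real.log (1 + A r) ≤ η * (1 + A r) + |Real.log η| := by
    have h0 := hS0 r hr1
    have h2 := Real.log_le_sub_one_of_pos (show 0 < η * (1 + A r) by positivity)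
    rw [Real.log_mul hη0.ne' (by positivity)] at h2
    linarith [neg_abs_le (Real.log η)]
  have hci : c i ≤ C := Finset.single_le_sum (f := c) (fun j _ ↦ hc j) hi
  have hlr : 0 ≤ Real.log r := Real.log_nonneg hr1
  calc ValueDistribution.proximity (logDeriv (f i)) ⊤ r
      ≤ C * (1 + Real.log (R + 1 / (R - r) + ValueDistribution.characteristic (f i) ⊤ R)) :=
        (hcle i hi r R hr1 hrR).trans (mul_le_mul_of_nonneg_right hci
          (by linarith [Real.log_nonneg hW0]))
    _ ≤ C * (1 + (Real.log 3 + Real.log r + (η * (1 + A r) + |Real.log η|))) := by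
        gcongr; linarith
    _ = C * (1 + Real.log 3) + C * η * (1 + A r) + C * |Real.log η| + C * Real.log r := by ring
    _ ≤ C * (1 + Real.log 3) + ε * (1 + A r) + C * |Real.log η| + C * Real.log r := by
        have := hS0 r hr1
        gcongr
    _ ≤ _ := by
        have := mul_nonneg hC2 hlr
        nlinarith

theorem finite_support_divisor_of_characteristic_le_log {f : ℂ → ℂ} (hf : Meromorphic f) {K : ℝ}
    (hK : ∀ r₀ : ℝ, ∃ r, r₀ ≤ r ∧ 1 ≤ r ∧
      ValueDistribution.characteristic f ⊤ r ≤ K * (1 + Real.log r)) :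
    (MeromorphicOn.divisor f univ).support.Finite := by
  by_contra hinf
  obtain ⟨c, hc, hsum⟩ := exists_sum_abs_divisor_mul_log_le hf
  obtain ⟨S, hS, hcard⟩ := Set.Infinite.exists_subset_card_eq hinf (⌈2 * |K|⌉₊ + 1)
  set M := ∑ u ∈ S, |(MeromorphicOn.divisor f univ u : ℝ)| with hM
  have hM1 : 2 * |K| + 1 ≤ M := by
    have h1 : (S.card : ℝ) ≤ M := by
      rw [hM, ← nsmul_one]
      refine Finset.card_nsmul_le_sum _ _ _ fun u hu ↦ ?_
      exact_mod_cast Int.one_le_abs (hS hu)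
    rw [hcard] at h1
    push_cast at h1
    linarith [Nat.le_ceil (2 * |K|)]
  set E := ∑ u ∈ S, |(MeromorphicOn.divisor f univ u : ℝ)| * Real.log ‖u‖ with hE
  obtain ⟨r, hr0, hr1, hr⟩ := hK (max (∑ u ∈ S, ‖u‖) (Real.exp (2 * |K| + c + E + 1)))
  have h2 := hsum r S hr1 fun u hu ↦ (Finset.single_le_sum (f := fun u ↦ ‖u‖)
    (fun i _ ↦ norm_nonneg i) hu).trans ((le_max_left _ _).trans hr0)
  have h3 : 2 * |K| + c + E + 1 ≤ Real.log r :=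
    (Real.le_log_iff_exp_le (by linarith)).2 ((le_max_right _ _).trans hr0)
  simp only [mul_sub, Finset.sum_sub_distrib, ← Finset.sum_mul, ← hM, ← hE] at h2
  have hlr := Real.log_nonneg hr1
  have h4 : K * (1 + Real.log r) ≤ |K| * (1 + Real.log r) :=
    mul_le_mul_of_nonneg_right (le_abs_self K) (by linarith)
  nlinarith [mul_le_mul_of_nonneg_right hM1 hlr]

theorem logDeriv_eq_zero_of_circleAverage_le_log {g : ℂ → ℂ} (hg : ∀ z, AnalyticAt ℂ g z)
    (hg0 : ∀ z, g z ≠ 0) {A : ℝ} (hA : ∀ r₀ : ℝ, ∃ r, r₀ ≤ r ∧ 1 ≤ r ∧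
      Real.circleAverage (fun w ↦ |Real.log ‖g w‖|) 0 r ≤ A * (1 + Real.log r)) (z : ℂ) :
    logDeriv g z = 0 := by
  have hlim : Tendsto (fun r : ℝ ↦ 8 * |A| * (1 / r + Real.log r / r)) atTop (𝓝 0) := by
    have h1 : Tendsto (fun r : ℝ ↦ Real.log r ^ 1 / (1 * r + 0)) atTop (𝓝 0) :=
      Real.tendsto_pow_log_div_mul_add_atTop 1 0 1 one_ne_zero
    have h2 : Tendsto (fun r : ℝ ↦ 1 / r) atTop (𝓝 0) := by
      simpa using tendsto_inv_atTop_zero (𝕜 := ℝ)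
    simpa using (h2.add h1).const_mul (8 * |A|)
  by_contra hne
  obtain ⟨r₁, hr₁⟩ := eventually_atTop.1
    (hlim.eventually (gt_mem_nhds (norm_pos_iff.2 hne)))
  obtain ⟨r, hr0, hr1, hr⟩ := hA (max r₁ (2 * ‖z‖ + 1))
  have h1 := hr₁ r ((le_max_left _ _).trans hr0)
  have h2 : 2 * ‖z‖ + 1 ≤ r := (le_max_right _ _).trans hr0
  have hz := norm_nonneg z
  refine absurd h1 (not_lt.2 ?_)
  have hlr := Real.log_nonneg hr1
  have h3 : 2 * r / (r - ‖z‖) ^ 2 ≤ 8 / r := by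
    rw [div_le_div_iff₀ (by nlinarith) (by linarith)]
    nlinarith
  refine (norm_logDeriv_le_circleAverage (fun w _ ↦ hg w) (fun w _ ↦ hg0 w)
    (show ‖z‖ < r by linarith)).trans ?_
  have h4 : A * (1 + Real.log r) ≤ |A| * (1 + Real.log r) :=
    mul_le_mul_of_nonneg_right (le_abs_self A) (by linarith)
  calc _ ≤ 2 * r / (r - ‖z‖) ^ 2 * (|A| * (1 + Real.log r)) :=
        mul_le_mul_of_nonneg_left (hr.trans h4) (by positivity)
    _ ≤ 8 / r * (|A| * (1 + Real.log r)) := mul_le_mul_of_nonneg_right h3 (by positivity)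
    _ = _ := by ring

/-- A function that is, up to a scalar, a product of integer powers of linear factors is a quotient
of polynomials. -/
theorem exists_polynomial_eq_div_of_eventuallyEq {f : ℂ → ℂ} {S : Finset ℂ} {d : ℂ → ℤ} {c : ℂ}
    (hnice : ∀ z, ContinuousAt f z ∨ Tendsto (fun w ↦ ‖f w‖) (𝓝[≠] z) atTop)
    (hf : ∀ z, ∀ᶠ w in 𝓝[≠] z, f w = (∏ u ∈ S, (w - u) ^ d u) * c) :
    ∃ P Q : Polynomial ℂ, Q ≠ 0 ∧ ∀ z : ℂ, Q.eval z ≠ 0 → f z = P.eval z / Q.eval z := by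
  refine ⟨(∏ u ∈ S, (Polynomial.X - Polynomial.C u) ^ (d u).toNat) * Polynomial.C c,
    ∏ u ∈ S, (Polynomial.X - Polynomial.C u) ^ (-d u).toNat,
    Finset.prod_ne_zero_iff.2 fun u _ ↦ pow_ne_zero _ (Polynomial.X_sub_C_ne_zero u),
    fun z hz ↦ ?_⟩
  set P := (∏ u ∈ S, (Polynomial.X - Polynomial.C u) ^ (d u).toNat) * Polynomial.C c with hP
  set Q := ∏ u ∈ S, (Polynomial.X - Polynomial.C u) ^ (-d u).toNat with hQ
  have hlim : Tendsto f (𝓝[≠] z) (𝓝 (P.eval z / Q.eval z)) := by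
    have h1 : Tendsto (fun w ↦ P.eval w / Q.eval w) (𝓝[≠] z) (𝓝 (P.eval z / Q.eval z)) :=
      ((P.continuous.continuousAt.div Q.continuous.continuousAt hz).tendsto).mono_left
        nhdsWithin_le_nhds
    refine h1.congr' ?_
    filter_upwards [hf z, eventually_nhdsNE_notMem_finset S z] with w hw hwS
    rw [hw, hP, hQ]
    simp only [Polynomial.eval_mul, Polynomial.eval_prod, Polynomial.eval_pow,
      Polynomial.eval_sub, Polynomial.eval_X, Polynomial.eval_C]
    rw [mul_div_right_comm, ← Finset.prod_div_distrib]
    congr 1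
    refine Finset.prod_congr rfl fun u hu ↦ ?_
    have hne : w - u ≠ 0 := sub_ne_zero.2 fun h ↦ hwS (h ▸ hu)
    rw [← zpow_natCast, ← zpow_natCast, ← zpow_sub₀ hne, Int.toNat_sub_toNat_neg]
  rcases hnice z with h | h
  · exact tendsto_nhds_unique (h.tendsto.mono_left nhdsWithin_le_nhds) hlim
  · exact absurd hlim.norm (not_tendsto_nhds_of_tendsto_atTop h _)

/-- A meromorphic function whose characteristic is at most a multiple of `log r` at arbitrarily
large radii is rational. -/
theorem exists_polynomial_eq_div_of_characteristic_le_log {f : ℂ → ℂ} (hf : Meromorphic f)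
    (hord : ∀ z, meromorphicOrderAt f z ≠ ⊤)
    (hnice : ∀ z, ContinuousAt f z ∨ Tendsto (fun w ↦ ‖f w‖) (𝓝[≠] z) atTop) {K : ℝ}
    (hK : ∀ r₀ : ℝ, ∃ r, r₀ ≤ r ∧ 1 ≤ r ∧
      ValueDistribution.characteristic f ⊤ r ≤ K * (1 + Real.log r)) :
    ∃ P Q : Polynomial ℂ, Q ≠ 0 ∧ ∀ z : ℂ, Q.eval z ≠ 0 → f z = P.eval z / Q.eval z := by
  obtain ⟨S, g, hS, hg, hg0, hfg⟩ := exists_factorization_of_finite_support hf hord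
    (finite_support_divisor_of_characteristic_le_log hf hK)
  obtain ⟨c, hc, havg⟩ := exists_circleAverage_abs_log_norm_le_characteristic hf
  set N := ∑ u ∈ S, |(MeromorphicOn.divisor f univ u : ℝ)| with hN
  have hN0 : 0 ≤ N := Finset.sum_nonneg fun _ _ ↦ abs_nonneg _
  have hlog : ∀ z, logDeriv g z = 0 := by
    refine logDeriv_eq_zero_of_circleAverage_le_log (A := 2 * K + c + 4 * N)
      (fun z ↦ hg z (mem_univ z)) (fun z ↦ hg0 z (mem_univ z)) fun r₀ ↦ ?_
    obtain ⟨r, hr0, hr1, hr⟩ := hK (max r₀ (∑ u ∈ S, ‖u‖))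
    refine ⟨r, (le_max_left _ _).trans hr0, hr1, ?_⟩
    have h1 := circleAverage_abs_log_norm_le_of_factorization hr1 hf
      (fun u hu ↦ (Finset.single_le_sum (f := fun u ↦ ‖u‖) (fun i _ ↦ norm_nonneg i) hu).trans
        ((le_max_right _ _).trans hr0)) (fun z _ ↦ hg z (mem_univ z))
      (fun z _ ↦ hg0 z (mem_univ z))
      fun z _ ↦ (hfg z (mem_univ z)).mono fun w hw _ ↦ hw (mem_univ w)
    have h2 := havg r hr1
    have hlr := Real.log_nonneg hr1
    have h3 : Real.log (2 * r) ≤ 1 + Real.log r := by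
      rw [Real.log_mul two_ne_zero (by linarith)]
      linarith [Real.log_two_lt_d9]
    have h4 : N * (2 * Real.log (2 * r)) ≤ N * (2 * (1 + Real.log r)) := by gcongr
    nlinarith [mul_nonneg hc hlr, mul_nonneg hN0 hlr]
  have hconst : ∀ z, g z = g 0 := fun z ↦ by
    refine is_const_of_deriv_eq_zero (fun z ↦ (hg z (mem_univ z)).differentiableAt)
      (fun w ↦ ?_) z 0
    have := hlog w
    rw [logDeriv_apply, div_eq_zero_iff] at this
    exact this.resolve_right (hg0 w (mem_univ w))
  exact exists_polynomial_eq_div_of_eventuallyEq hnice fun z ↦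
    (hfg z (mem_univ z)).mono fun w hw ↦ by rw [hw (mem_univ w), hconst w]

theorem Meromorphic.iteratedDeriv {f : ℂ → ℂ} (hf : Meromorphic f) (j : ℕ) :
    Meromorphic (iteratedDeriv j f) := by
  rw [iteratedDeriv_eq_iterate]
  exact hf.iterated_deriv

theorem meromorphicOrderAt_iteratedDeriv_eq_sub {f : ℂ → ℂ} {z : ℂ} {p : ℤ}
    (hp : meromorphicOrderAt f z = p) (k : ℕ) (hpk : ∀ j < k, p ≠ j) :
    meromorphicOrderAt (iteratedDeriv k f) z = ((p - k : ℤ) : WithTop ℤ) := by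
  induction k with
  | zero => simpa using hp
  | succ k ih =>
    have h1 := ih fun j hj ↦ hpk j (hj.trans k.lt_succ_self)
    have h2 : ((p - k : ℤ) : ℂ) ≠ 0 :=
      Int.cast_ne_zero.2 (sub_ne_zero.2 (hpk k k.lt_succ_self))
    rw [iteratedDeriv_succ, meromorphicOrderAt_deriv_eq_sub_one h2 h1]
    congr 1
    push_cast
    ring

theorem analyticAt_of_meromorphicOrderAt_nonneg {f : ℂ → ℂ} {z : ℂ} (hf : MeromorphicAt f z)
    (hnice : ContinuousAt f z ∨ Tendsto (fun w ↦ ‖f w‖) (𝓝[≠] z) atTop)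
    (h : 0 ≤ meromorphicOrderAt f z) : AnalyticAt ℂ f z := by
  refine hf.analyticAt (hnice.resolve_right fun h1 ↦ ?_)
  obtain ⟨c, hc⟩ := (tendsto_nhds_iff_meromorphicOrderAt_nonneg hf).2 h
  exact not_tendsto_nhds_of_tendsto_atTop h1 _ hc.norm

/-- An entire function whose derivatives at the origin eventually vanish is a polynomial. -/
theorem exists_polynomial_eq_of_iteratedDeriv_eq_zero {f : ℂ → ℂ} (hf : Differentiable ℂ f) {N : ℕ}
    (h : ∀ n, N ≤ n → iteratedDeriv n f 0 = 0) : ∃ P : Polynomial ℂ, ∀ z, f z = P.eval z := by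
  refine ⟨∑ n ∈ Finset.range N, Polynomial.C ((n.factorial : ℂ)⁻¹ * iteratedDeriv n f 0) *
    Polynomial.X ^ n, fun z ↦ ?_⟩
  rw [← Complex.taylorSeries_eq_of_entire' (c := 0) z hf, tsum_eq_sum (s := Finset.range N)]
  · simp [Polynomial.eval_finsetSum]
  · intro n hn
    rw [h n (by simpa using hn)]
    simp

/-- A meromorphic function one of whose derivatives is a monomial is rational. -/
theorem exists_polynomial_of_iteratedDeriv_sub_eq_top {f : ℂ → ℂ} (hf : Meromorphic f)
    (hnice : ∀ z, ContinuousAt f z ∨ Tendsto (fun w ↦ ‖f w‖) (𝓝[≠] z) atTop) {k l : ℕ} {c z₀ : ℂ}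
    (h : meromorphicOrderAt (fun w ↦ iteratedDeriv k f w - c * w ^ l) z₀ = ⊤) :
    ∃ P Q : Polynomial ℂ, Q ≠ 0 ∧ ∀ z : ℂ, Q.eval z ≠ 0 → f z = P.eval z / Q.eval z := by
  have hpow : ∀ z : ℂ, AnalyticAt ℂ (fun w ↦ c * w ^ l) z := fun z ↦ by fun_prop
  have hall : ∀ z, meromorphicOrderAt (fun w ↦ iteratedDeriv k f w - c * w ^ l) z = ⊤ := by
    have hm : Meromorphic (fun w ↦ iteratedDeriv k f w - c * w ^ l) := fun z ↦
      (hf.iteratedDeriv k z).sub (hpow z).meromorphicAt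
    have := mt hm.exists_meromorphicOrderAt_ne_top_iff_forall.1
    push Not at this
    exact this ⟨z₀, h⟩
  have heq : ∀ z, iteratedDeriv k f =ᶠ[𝓝[≠] z] fun w ↦ c * w ^ l := fun z ↦
    (meromorphicOrderAt_eq_top_iff.1 (hall z)).mono fun w hw ↦ sub_eq_zero.1 hw
  have han : ∀ z, AnalyticAt ℂ f z := fun z ↦ by
    refine analyticAt_of_meromorphicOrderAt_nonneg (hf z) (hnice z) ?_
    by_contra! hneg
    obtain ⟨p, hp⟩ := WithTop.ne_top_iff_exists.1 hneg.ne_top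
    rw [← hp] at hneg
    have hp0 : p < 0 := by exact_mod_cast hneg
    have h1 := meromorphicOrderAt_iteratedDeriv_eq_sub hp.symm k fun j _ ↦ by omega
    rw [meromorphicOrderAt_congr (heq z)] at h1
    have h2 := (hpow z).meromorphicOrderAt_nonneg
    rw [h1] at h2
    have h3 : (0 : ℤ) ≤ p - k := by exact_mod_cast h2
    omega
  have heq' : iteratedDeriv k f = fun w ↦ c * w ^ l := by
    ext z
    have h1 : ContinuousAt (iteratedDeriv k f) z := by
      rw [iteratedDeriv_eq_iterate]
      exact (han z).iterated_deriv k |>.continuousAt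
    have h2 := (hpow z).continuousAt.tendsto.mono_left (nhdsWithin_le_nhds (s := {z}ᶜ))
    exact tendsto_nhds_unique (h1.tendsto.mono_left nhdsWithin_le_nhds) (h2.congr' (heq z).symm)
  obtain ⟨P, hP⟩ := exists_polynomial_eq_of_iteratedDeriv_eq_zero
    (fun z ↦ (han z).differentiableAt) (N := k + l + 1) fun n hn ↦ by
      obtain ⟨j, rfl⟩ := Nat.exists_eq_add_of_le (show k ≤ n by omega)
      rw [iteratedDeriv_eq_iterate, add_comm, Function.iterate_add_apply,
        ← iteratedDeriv_eq_iterate (n := k), heq', ← iteratedDeriv_eq_iterate,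
        iteratedDeriv_const_mul_field, iteratedDeriv_pow]
      simp [Nat.descFactorial_of_lt (show l < j by omega)]
  exact ⟨P, 1, one_ne_zero, fun z _ ↦ by simp [hP z]⟩

theorem exists_meromorphicOrderAt_sub_const_eq_top {f : ℂ → ℂ} (hf : Meromorphic f) {z : ℂ}
    (h : meromorphicOrderAt (deriv f) z = ⊤) :
    ∃ c w, meromorphicOrderAt (fun x ↦ f x - c) w = ⊤ := by
  have h1 := eventually_eventually_nhdsWithin.2 (meromorphicOrderAt_eq_top_iff.1 h)
  obtain ⟨w, ⟨h2, h3⟩, hwz⟩ :=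
    ((h1.and (hf z).eventually_analyticAt).and eventually_mem_nhdsWithin).exists
  have h4 : ∀ᶠ x in 𝓝 w, deriv f x = 0 := by
    rwa [isOpen_compl_singleton.nhdsWithin_eq hwz] at h2
  obtain ⟨ε, hε, hball⟩ := Metric.eventually_nhds_iff_ball.1 (h4.and h3.eventually_analyticAt)
  refine ⟨f w, w, meromorphicOrderAt_eq_top_iff.2 (nhdsWithin_le_nhds ?_)⟩
  filter_upwards [Metric.ball_mem_nhds w hε] with x hx
  rw [sub_eq_zero]
  exact (convex_ball w ε).is_const_of_fderivWithin_eq_zero (𝕜 := ℂ)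
    (fun y hy ↦ (hball y hy).2.differentiableAt.differentiableWithinAt)
    (fun y hy ↦ by
      rw [fderivWithin_of_isOpen Metric.isOpen_ball hy]
      ext
      simpa using (hball y hy).1) hx (Metric.mem_ball_self hε)

open ValueDistribution

theorem coe_divisor_univ {f : ℂ → ℂ} (hf : Meromorphic f) {z : ℂ}
    (h : meromorphicOrderAt f z ≠ ⊤) :
    ((MeromorphicOn.divisor f univ z : ℤ) : WithTop ℤ) = meromorphicOrderAt f z := by
  rw [MeromorphicOn.divisor_apply (fun z _ ↦ hf z) (mem_univ z), WithTop.coe_untop₀_of_ne_top h]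

/-- Changing a divisor at the origin changes its counting function by at most a multiple of
`log r`. -/
theorem exists_logCounting_le_of_forall_ne_zero {D₁ D₂ : Function.locallyFinsupp ℂ ℤ}
    (h : ∀ z, z ≠ 0 → D₁ z ≤ D₂ z) :
    ∃ A : ℝ, 0 ≤ A ∧ ∀ r : ℝ, 1 ≤ r → Function.locallyFinsuppWithin.logCounting D₁ r ≤
      Function.locallyFinsuppWithin.logCounting D₂ r + A * Real.log r := by
  refine ⟨(|D₁ 0 - D₂ 0| : ℤ), by positivity, fun r hr ↦ ?_⟩
  have h1 : D₁ ≤ D₂ + Function.locallyFinsuppWithin.single 0 |D₁ 0 - D₂ 0| := by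
    intro z
    rw [Function.locallyFinsuppWithin.coe_add, Pi.add_apply,
      Function.locallyFinsuppWithin.single_apply]
    split_ifs with hz
    · rw [hz]; linarith [le_abs_self (D₁ 0 - D₂ 0)]
    · simpa using h z hz
  refine (Function.locallyFinsuppWithin.logCounting_le h1 hr).trans (le_of_eq ?_)
  rw [map_add, Pi.add_apply, Function.locallyFinsuppWithin.logCounting_single_eq_log_sub_const
    (by simpa using zero_le_one.trans hr)]
  simp

theorem negPart_divisor_deriv_le {f : ℂ → ℂ} (hf : Meromorphic f)
    (hord : ∀ z, meromorphicOrderAt f z ≠ ⊤) :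
    (MeromorphicOn.divisor (deriv f) univ)⁻ ≤ 2 • (MeromorphicOn.divisor f univ)⁻ := by
  intro z
  rw [Function.locallyFinsuppWithin.coe_nsmul, Pi.smul_apply,
    Function.locallyFinsuppWithin.negPart_apply, Function.locallyFinsuppWithin.negPart_apply]
  by_cases htop : meromorphicOrderAt (deriv f) z = ⊤
  · rw [MeromorphicOn.divisor_apply (fun z _ ↦ hf.deriv z) (mem_univ z), htop]
    simp
  have h1 := coe_divisor_univ hf (hord z)
  have h2 := coe_divisor_univ hf.deriv htop
  rw [negPart_def, negPart_def]
  rcases eq_or_ne (MeromorphicOn.divisor f univ z) 0 with h0 | h0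
  · rw [h0] at h1
    have h3 := meromorphicOrderAt_logDeriv_nonneg (hf z) (by rw [← h1]; rfl)
    rw [logDeriv, meromorphicOrderAt_div (hf z).deriv (hf z), ← h1, ← h2] at h3
    have h4 : (0 : ℤ) ≤ MeromorphicOn.divisor (deriv f) univ z - 0 := by exact_mod_cast h3
    rw [h0]
    simp only [nsmul_eq_mul, Nat.cast_ofNat]
    omega
  · rw [meromorphicOrderAt_deriv_eq_sub_one (Int.cast_ne_zero.2 h0) h1.symm] at h2
    have h3 : MeromorphicOn.divisor (deriv f) univ z = MeromorphicOn.divisor f univ z - 1 := by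
      exact_mod_cast h2
    rw [h3]
    simp only [nsmul_eq_mul, Nat.cast_ofNat]
    omega

theorem eventually_codiscrete_ne_zero {f : ℂ → ℂ} (hf : Meromorphic f)
    (hord : ∀ z, meromorphicOrderAt f z ≠ ⊤) : ∀ᶠ z in codiscrete ℂ, f z ≠ 0 :=
  MeromorphicOn.eventually_codiscreteWithin_apply_ne_zero (fun z _ ↦ hf z) fun z _ ↦ hord z

theorem proximity_deriv_le {f : ℂ → ℂ} (hf : Meromorphic f)
    (hord : ∀ z, meromorphicOrderAt f z ≠ ⊤) {r : ℝ} (hr : 1 ≤ r) :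
    proximity (deriv f) ⊤ r ≤ proximity f ⊤ r + proximity (logDeriv f) ⊤ r := by
  have h1 : deriv f =ᶠ[codiscrete ℂ] f * logDeriv f := by
    filter_upwards [eventually_codiscrete_ne_zero hf hord] with z hz
    rw [Pi.mul_apply, logDeriv_apply, mul_div_cancel₀ _ hz]
  rw [proximity_congr_codiscrete h1 (by linarith)]
  exact proximity_mul_top_le hf hf.logDeriv r

theorem characteristic_deriv_le {f : ℂ → ℂ} (hf : Meromorphic f)
    (hord : ∀ z, meromorphicOrderAt f z ≠ ⊤) {r : ℝ} (hr : 1 ≤ r) :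
    characteristic (deriv f) ⊤ r ≤ 2 * characteristic f ⊤ r + proximity (logDeriv f) ⊤ r := by
  have h1 := proximity_deriv_le hf hord hr
  have h2 := Function.locallyFinsuppWithin.logCounting_le (negPart_divisor_deriv_le hf hord) hr
  rw [map_nsmul, ← logCounting_top, ← logCounting_top, Pi.smul_apply, nsmul_eq_mul] at h2
  have h3 : 0 ≤ proximity f ⊤ r := proximity_nonneg r
  have h4 : characteristic f ⊤ r = proximity f ⊤ r + logCounting f ⊤ r := rfl
  have h5 : characteristic (deriv f) ⊤ r =
    proximity (deriv f) ⊤ r + logCounting (deriv f) ⊤ r := rfl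
  push_cast at h2
  linarith

theorem characteristic_iteratedDeriv_add_le {f : ℂ → ℂ} (hf : Meromorphic f) {k : ℕ}
    (hord : ∀ j < k, ∀ z, meromorphicOrderAt (iteratedDeriv j f) z ≠ ⊤) {r s : ℝ} (hr : 1 ≤ r)
    (h : ∀ j < k, proximity (logDeriv (iteratedDeriv j f)) ⊤ r ≤ s) :
    characteristic (iteratedDeriv k f) ⊤ r + s ≤ 2 ^ k * (characteristic f ⊤ r + s) := by
  induction k with
  | zero => simp
  | succ k ih =>
    have h1 := ih (fun j hj ↦ hord j (hj.trans k.lt_succ_self))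
      fun j hj ↦ h j (hj.trans k.lt_succ_self)
    have h2 := characteristic_deriv_le (hf.iteratedDeriv k) (hord k k.lt_succ_self) hr
    have h3 := h k k.lt_succ_self
    rw [iteratedDeriv_succ, pow_succ]
    linarith

theorem proximity_iteratedDeriv_mul_inv_le {f : ℂ → ℂ} (hf : Meromorphic f) {k : ℕ}
    (hord₀ : ∀ z, meromorphicOrderAt f z ≠ ⊤)
    (hord : ∀ j < k, ∀ z, meromorphicOrderAt (iteratedDeriv j f) z ≠ ⊤) {r s : ℝ} (hr : 1 ≤ r)
    (h : ∀ j < k, proximity (logDeriv (iteratedDeriv j f)) ⊤ r ≤ s) :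
    proximity (iteratedDeriv k f * f⁻¹) ⊤ r ≤ k * s := by
  induction k with
  | zero =>
    have h1 : iteratedDeriv 0 f * f⁻¹ =ᶠ[codiscrete ℂ] fun _ ↦ 1 := by
      filter_upwards [eventually_codiscrete_ne_zero hf hord₀] with z hz
      simp [hz]
    rw [proximity_congr_codiscrete h1 (by linarith), proximity_const]
    simp
  | succ k ih =>
    have h1 := ih (fun j hj ↦ hord j (hj.trans k.lt_succ_self))
      fun j hj ↦ h j (hj.trans k.lt_succ_self)
    have h2 : iteratedDeriv (k + 1) f * f⁻¹ =ᶠ[codiscrete ℂ]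
        (iteratedDeriv k f * f⁻¹) * logDeriv (iteratedDeriv k f) := by
      filter_upwards [eventually_codiscrete_ne_zero (hf.iteratedDeriv k)
        (hord k k.lt_succ_self)] with z hz
      simp only [Pi.mul_apply, logDeriv_apply, iteratedDeriv_succ]
      field_simp
    have h3 := h k k.lt_succ_self
    rw [proximity_congr_codiscrete h2 (by linarith)]
    refine (proximity_mul_top_le ((hf.iteratedDeriv k).mul hf.inv)
      (hf.iteratedDeriv k).logDeriv r).trans ?_
    push_cast
    rw [Pi.add_apply]
    linarith

/-- Jensen's formula, as a bound for the proximity function of the reciprocal. -/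
theorem exists_proximity_inv_le {f : ℂ → ℂ} (hf : Meromorphic f) :
    ∃ c : ℝ, 0 ≤ c ∧ ∀ r : ℝ, 1 ≤ r → proximity f⁻¹ ⊤ r ≤ proximity f ⊤ r -
      Function.locallyFinsuppWithin.logCounting (MeromorphicOn.divisor f univ) r + c := by
  refine ⟨|Real.log ‖meromorphicTrailingCoeffAt f 0‖|, abs_nonneg _, fun r hr ↦ ?_⟩
  have h1 := congrFun (proximity_sub_proximity_inv_eq_circleAverage hf) r
  rw [Pi.sub_apply] at h1
  rw [Function.locallyFinsuppWithin.logCounting_divisor_eq_circleAverage_sub_const hf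
    (by linarith), ← h1]
  linarith [neg_abs_le (Real.log ‖meromorphicTrailingCoeffAt f 0‖)]

theorem proximity_inv_pow {l : ℕ} {r : ℝ} (hr : 1 ≤ r) :
    proximity (fun z : ℂ ↦ (z ^ l)⁻¹) ⊤ r = 0 := by
  rw [proximity_top]
  have : ∀ z ∈ Metric.sphere (0 : ℂ) |r|, Real.posLog ‖(z ^ l)⁻¹‖ = 0 := by
    intro z hz
    have hz' : ‖z‖ = r := by simpa [abs_of_pos (show 0 < r by linarith)] using hz
    rw [Real.posLog_eq_zero_iff, norm_inv, norm_pow, hz', abs_of_nonneg (by positivity)]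
    exact inv_le_one_of_one_le₀ (one_le_pow₀ hr)
  rw [Real.circleAverage_congr_sphere (f₂ := fun _ ↦ 0) this, Real.circleAverage_const]

theorem meromorphic_inv_pow (l : ℕ) : Meromorphic fun z : ℂ ↦ (z ^ l)⁻¹ := fun z ↦ by fun_prop

theorem exists_characteristic_inv_le {f : ℂ → ℂ} (hf : Meromorphic f) :
    ∃ c : ℝ, 0 ≤ c ∧ ∀ r : ℝ, characteristic f⁻¹ ⊤ r ≤ characteristic f ⊤ r + c ∧
      characteristic f ⊤ r ≤ characteristic f⁻¹ ⊤ r + c := by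
  refine ⟨_, (abs_nonneg _).trans (le_max_left |Real.log ‖f 0‖|
    |Real.log ‖meromorphicTrailingCoeffAt f 0‖|), fun r ↦ ?_⟩
  have h := abs_le.1 (characteristic_sub_characteristic_inv_le (R := r) hf)
  constructor <;> linarith [h.1, h.2]

theorem meromorphicOrderAt_deriv_nonneg {f : ℂ → ℂ} {z : ℂ} (hf : MeromorphicAt f z)
    (h : 0 ≤ meromorphicOrderAt f z) : 0 ≤ meromorphicOrderAt (deriv f) z := by
  by_cases htop : meromorphicOrderAt f z = ⊤
  · have h1 : f =ᶠ[𝓝[≠] z] fun _ ↦ 0 := meromorphicOrderAt_eq_top_iff.1 htop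
    rw [meromorphicOrderAt_congr h1.nhdsNE_deriv]
    simp [meromorphicOrderAt_const]
  obtain ⟨p, hp⟩ := WithTop.ne_top_iff_exists.1 htop
  rcases eq_or_ne p 0 with rfl | hp0
  · have h1 := meromorphicOrderAt_logDeriv_nonneg hf (by rw [← hp]; rfl)
    rw [logDeriv, meromorphicOrderAt_div hf.deriv hf, ← hp] at h1
    simpa using h1
  · rw [meromorphicOrderAt_deriv_eq_sub_one (Int.cast_ne_zero.2 hp0) hp.symm]
    have h1 : (0 : ℤ) ≤ p := by rw [← hp] at h; exact_mod_cast h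
    have h2 : (0 : ℤ) ≤ p - 1 := by omega
    exact_mod_cast h2

theorem meromorphicOrderAt_iteratedDeriv_nonneg {f : ℂ → ℂ} {z : ℂ} (hf : MeromorphicAt f z)
    (h : 0 ≤ meromorphicOrderAt f z) (k : ℕ) : 0 ≤ meromorphicOrderAt (iteratedDeriv k f) z := by
  induction k with
  | zero => simpa using h
  | succ k ih =>
    rw [iteratedDeriv_succ]
    refine meromorphicOrderAt_deriv_nonneg ?_ ih
    rw [iteratedDeriv_eq_iterate]
    exact hf.iterated_deriv

/-- The quotient of the `k`-th derivative of a function by `z ^ l`. -/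
def iteratedDerivDivPow (k l : ℕ) (f : ℂ → ℂ) : ℂ → ℂ :=
  iteratedDeriv k f * fun z ↦ (z ^ l)⁻¹

theorem Meromorphic.iteratedDerivDivPow {f : ℂ → ℂ} (hf : Meromorphic f) (k l : ℕ) :
    Meromorphic (iteratedDerivDivPow k l f) :=
  (hf.iteratedDeriv k).mul (meromorphic_inv_pow l)

theorem meromorphicOrderAt_iteratedDerivDivPow {f : ℂ → ℂ} {k l : ℕ} {z : ℂ} (hz : z ≠ 0) :
    meromorphicOrderAt (iteratedDerivDivPow k l f) z =
      meromorphicOrderAt (iteratedDeriv k f) z := by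
  rw [iteratedDerivDivPow, mul_comm]
  exact meromorphicOrderAt_mul_of_ne_zero (by fun_prop (disch := exact pow_ne_zero _ hz))
    (inv_ne_zero (pow_ne_zero _ hz))

theorem meromorphicOrderAt_iteratedDerivDivPow_eq {f : ℂ → ℂ} {k l : ℕ} {z : ℂ} (hz : z ≠ 0)
    {p : ℤ} (hp : meromorphicOrderAt f z = p) (hpk : ∀ j < k, p ≠ j) :
    meromorphicOrderAt (iteratedDerivDivPow k l f) z = ((p - k : ℤ) : WithTop ℤ) := by
  rw [meromorphicOrderAt_iteratedDerivDivPow hz, meromorphicOrderAt_iteratedDeriv_eq_sub hp k hpk]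

theorem meromorphicOrderAt_sub_one_eq_zero {G : ℂ → ℂ} {z : ℂ} (hG : MeromorphicAt G z)
    (h : 0 < meromorphicOrderAt G z) : meromorphicOrderAt (fun w ↦ G w - 1) z = 0 := by
  have h1 : meromorphicOrderAt (fun _ : ℂ ↦ (-1 : ℂ)) z = 0 := by
    simp [meromorphicOrderAt_const]
  have h2 : (fun w ↦ G w - 1) = (fun _ ↦ (-1 : ℂ)) + G := by
    ext w; simp [sub_eq_add_neg, add_comm]
  rw [h2, meromorphicOrderAt_add_eq_left_of_lt hG (by rwa [h1]), h1]

theorem meromorphicOrderAt_sub_one_eq {G : ℂ → ℂ} {z : ℂ}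
    (h : meromorphicOrderAt G z < 0) :
    meromorphicOrderAt (fun w ↦ G w - 1) z = meromorphicOrderAt G z := by
  have h1 : meromorphicOrderAt (fun _ : ℂ ↦ (-1 : ℂ)) z = 0 := by
    simp [meromorphicOrderAt_const]
  have h2 : (fun w ↦ G w - 1) = G + fun _ ↦ (-1 : ℂ) := by
    ext w; simp [sub_eq_add_neg]
  rw [h2, meromorphicOrderAt_add_eq_left_of_lt (MeromorphicAt.const _ _) (by rwa [h1])]

theorem meromorphicOrderAt_sub_one_nonneg {G : ℂ → ℂ} {z : ℂ} (hG : MeromorphicAt G z)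
    (h : 0 ≤ meromorphicOrderAt G z) : 0 ≤ meromorphicOrderAt (fun w ↦ G w - 1) z := by
  obtain ⟨c, hc⟩ := (tendsto_nhds_iff_meromorphicOrderAt_nonneg hG).2 h
  refine (tendsto_nhds_iff_meromorphicOrderAt_nonneg ?_).1 ⟨_, hc.sub_const 1⟩
  fun_prop

/-- Local comparison of multiplicities behind the counting-function estimate. -/
theorem mul_posPart_sub_divisor_logDeriv_le {f : ℂ → ℂ} (hf : Meromorphic f) {k l m n : ℕ}
    (hkn : k < n) {z : ℂ} (hz : z ≠ 0) {p q d : ℤ} (hp : meromorphicOrderAt f z = p)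
    (hq : meromorphicOrderAt (fun w ↦ iteratedDerivDivPow k l f w - 1) z = q)
    (hd : meromorphicOrderAt (logDeriv fun w ↦ iteratedDerivDivPow k l f w - 1) z = d)
    (hpos : 0 < p → (n : ℤ) ≤ p) (hneg : p < 0 → p ≤ -n) (hqm : 0 < q → (m : ℤ) ≤ q) :
    (m * n : ℤ) * (p⁺ - d) ≤ m * (k + 1) * p⁺ + m * p⁻ + n * q⁺ := by
  have hG := hf.iteratedDerivDivPow k l
  have hF : Meromorphic fun w ↦ iteratedDerivDivPow k l f w - 1 := fun w ↦ by
    have := hG w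
    fun_prop
  have hd_neg_one : q ≠ 0 → d = -1 := fun hq0 ↦ by
    have h1 := meromorphicOrderAt_logDeriv_eq_neg_one (hF z)
      (by rw [hq]; exact_mod_cast hq0) (by rw [hq]; simp)
    rw [hd] at h1
    exact WithTop.coe_injective h1
  have hd_nonneg : q = 0 → 0 ≤ d := fun hq0 ↦ by
    have h1 := meromorphicOrderAt_logDeriv_nonneg (hF z) (by rw [hq, hq0]; rfl)
    rw [hd] at h1
    exact_mod_cast h1
  have hm : (0 : ℤ) ≤ m := by positivity
  have hn : (0 : ℤ) ≤ n := by positivity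
  rcases lt_trichotomy p 0 with hp0 | hp0 | hp0
  · have h1 := meromorphicOrderAt_iteratedDerivDivPow_eq (l := l) hz hp (k := k)
      fun j _ ↦ by omega
    have h2 : p - (k : ℤ) < 0 := by omega
    rw [meromorphicOrderAt_sub_one_eq (by rw [h1]; exact_mod_cast h2), h1] at hq
    have h3 : p - k = q := by exact_mod_cast hq
    rw [hd_neg_one (by omega), posPart_eq_zero.2 hp0.le, negPart_eq_neg.2 hp0.le,
      posPart_eq_zero.2 (show q ≤ 0 by omega)]
    nlinarith [hneg hp0]
  · subst hp0
    have h1 : 0 ≤ q := by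
      have := meromorphicOrderAt_sub_one_nonneg (hG z) (by
        rw [meromorphicOrderAt_iteratedDerivDivPow hz]
        exact meromorphicOrderAt_iteratedDeriv_nonneg (hf z) hp.ge k)
      rw [hq] at this
      exact_mod_cast this
    rcases h1.eq_or_lt with h2 | h2
    · rw [← h2]
      simpa using mul_nonneg (mul_nonneg hm hn) (hd_nonneg h2.symm)
    · rw [hd_neg_one h2.ne', posPart_eq_self.2 h1]
      simpa [mul_comm] using mul_le_mul_of_nonneg_left (hqm h2) hn
  · have h1 := hpos hp0
    have h2 := meromorphicOrderAt_iteratedDerivDivPow_eq (l := l) hz hp (k := k)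
      fun j _ ↦ by omega
    have h3 : 0 < p - (k : ℤ) := by omega
    have h4 := meromorphicOrderAt_sub_one_eq_zero (hG z) (by rw [h2]; exact_mod_cast h3)
    have h5 : deriv (fun w ↦ iteratedDerivDivPow k l f w - 1) =
        deriv (iteratedDerivDivPow k l f) := by
      ext w; exact deriv_sub_const _
    rw [logDeriv, meromorphicOrderAt_div (hF z).deriv (hF z), h4, h5,
      meromorphicOrderAt_deriv_eq_sub_one (Int.cast_ne_zero.2 h3.ne') h2] at hd
    have h6 : d = p - k - 1 := by
      rw [sub_zero] at hd
      exact_mod_cast hd.symm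
    rw [posPart_eq_self.2 hp0.le, h6]
    have h7 : (0 : ℤ) ≤ m * p⁻ := mul_nonneg hm (negPart_nonneg _)
    have h8 : (0 : ℤ) ≤ n * q⁺ := mul_nonneg hn (posPart_nonneg _)
    have h9 : (m : ℤ) * (k + 1) * n ≤ m * (k + 1) * p := by gcongr
    linarith

theorem exists_logCounting_zero_le {f : ℂ → ℂ} (hf : Meromorphic f) :
    ∃ c : ℝ, 0 ≤ c ∧ ∀ r : ℝ, logCounting f 0 r ≤ characteristic f ⊤ r + c := by
  obtain ⟨c, hc, h⟩ := exists_characteristic_inv_le hf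
  refine ⟨c, hc, fun r ↦ le_trans ?_ (h r).1⟩
  have : 0 ≤ proximity f⁻¹ ⊤ r := proximity_nonneg r
  rw [characteristic, Pi.add_apply, logCounting_inv]
  linarith

theorem abs_characteristic_sub_one_sub_le {f : ℂ → ℂ} (hf : Meromorphic f) (r : ℝ) :
    |characteristic f ⊤ r - characteristic (fun w ↦ f w - 1) ⊤ r| ≤ Real.log 2 := by
  simpa using abs_characteristic_sub_characteristic_shift_le (a₀ := 1) (r := r) hf

/-- The multiplicity conditions on the zeros and poles of `f` and on the zeros of
`iteratedDeriv k f z - z ^ l`, away from the origin, together with the non-degeneracy of the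
functions derived from `f`. -/
structure MultiplicityConditions (k l m n : ℕ) (f : ℂ → ℂ) : Prop where
  meromorphic : Meromorphic f
  order_iteratedDeriv_ne_top : ∀ j ≤ k, ∀ z, meromorphicOrderAt (iteratedDeriv j f) z ≠ ⊤
  order_sub_one_ne_top :
    ∀ z, meromorphicOrderAt (fun w ↦ iteratedDerivDivPow k l f w - 1) z ≠ ⊤
  order_deriv_ne_top :
    ∀ z, meromorphicOrderAt (deriv fun w ↦ iteratedDerivDivPow k l f w - 1) z ≠ ⊤
  lt : k < n
  le_of_pos : ∀ z ≠ 0, ∀ p : ℤ, meromorphicOrderAt f z = p → 0 < p → (n : ℤ) ≤ p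
  le_of_neg : ∀ z ≠ 0, ∀ p : ℤ, meromorphicOrderAt f z = p → p < 0 → p ≤ -n
  le_of_sub_one_pos : ∀ z ≠ 0, ∀ q : ℤ,
    meromorphicOrderAt (fun w ↦ iteratedDerivDivPow k l f w - 1) z = q → 0 < q → (m : ℤ) ≤ q

namespace MultiplicityConditions

variable {k l m n : ℕ} {f : ℂ → ℂ}

theorem order_ne_top (hf : MultiplicityConditions k l m n f) (z : ℂ) :
    meromorphicOrderAt f z ≠ ⊤ := by
  simpa using hf.order_iteratedDeriv_ne_top 0 (Nat.zero_le k) z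

theorem meromorphic_derivDivPow (hf : MultiplicityConditions k l m n f) :
    Meromorphic (iteratedDerivDivPow k l f) :=
  hf.meromorphic.iteratedDerivDivPow k l

theorem meromorphic_sub_one (hf : MultiplicityConditions k l m n f) :
    Meromorphic fun w ↦ iteratedDerivDivPow k l f w - 1 := fun w ↦ by
  have := hf.meromorphic_derivDivPow w
  fun_prop

theorem order_derivDivPow_ne_top (hf : MultiplicityConditions k l m n f) (z : ℂ) :
    meromorphicOrderAt (iteratedDerivDivPow k l f) z ≠ ⊤ := by
  refine hf.meromorphic_derivDivPow.exists_meromorphicOrderAt_ne_top_iff_forall.1 ⟨1, ?_⟩ z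
  rw [meromorphicOrderAt_iteratedDerivDivPow one_ne_zero]
  exact hf.order_iteratedDeriv_ne_top k le_rfl 1

theorem order_logDeriv_ne_top (hf : MultiplicityConditions k l m n f) (z : ℂ) :
    meromorphicOrderAt (logDeriv fun w ↦ iteratedDerivDivPow k l f w - 1) z ≠ ⊤ := by
  rw [logDeriv, meromorphicOrderAt_div (hf.meromorphic_sub_one z).deriv (hf.meromorphic_sub_one z)]
  obtain ⟨p, hp⟩ := WithTop.ne_top_iff_exists.1 (hf.order_deriv_ne_top z)
  obtain ⟨q, hq⟩ := WithTop.ne_top_iff_exists.1 (hf.order_sub_one_ne_top z)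
  rw [← hp, ← hq]
  exact WithTop.coe_ne_top (a := p - q)

/-- The proximity function of `f⁻¹` is controlled by those of logarithmic derivatives. -/
theorem proximity_inv_le (hf : MultiplicityConditions k l m n f) {r s : ℝ} (hr : 1 ≤ r)
    (h : ∀ j < k, proximity (logDeriv (iteratedDeriv j f)) ⊤ r ≤ s)
    (hG : proximity (logDeriv (iteratedDerivDivPow k l f)) ⊤ r ≤ s) :
    proximity f⁻¹ ⊤ r ≤ (k + 1) * s +
      proximity (logDeriv fun w ↦ iteratedDerivDivPow k l f w - 1)⁻¹ ⊤ r + Real.log 2 := by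
  set L := logDeriv fun w ↦ iteratedDerivDivPow k l f w - 1 with hL
  have hLm : Meromorphic L := hf.meromorphic_sub_one.logDeriv
  have hGm : Meromorphic (logDeriv (iteratedDerivDivPow k l f)) :=
    hf.meromorphic_derivDivPow.logDeriv
  have hc : ∀ c : ℂ, Meromorphic fun _ : ℂ ↦ c := fun c z ↦ MeromorphicAt.const c z
  have hkey : f⁻¹ =ᶠ[codiscrete ℂ] ((iteratedDeriv k f * f⁻¹) * fun z ↦ (z ^ l)⁻¹) *
      ((fun _ ↦ 1) + (fun _ ↦ -1) * L⁻¹ * logDeriv (iteratedDerivDivPow k l f)) := by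
    filter_upwards [eventually_codiscrete_ne_zero hf.meromorphic_derivDivPow
        hf.order_derivDivPow_ne_top,
      eventually_codiscrete_ne_zero hf.meromorphic_sub_one hf.order_sub_one_ne_top,
      eventually_codiscrete_ne_zero hf.meromorphic_sub_one.deriv hf.order_deriv_ne_top]
      with z h1 h2 h3
    have h4 : deriv (fun w ↦ iteratedDerivDivPow k l f w - 1) z =
      deriv (iteratedDerivDivPow k l f) z := deriv_sub_const _
    rw [h4] at h3
    have h5 : iteratedDeriv k f z * (z ^ l)⁻¹ = iteratedDerivDivPow k l f z := rfl
    simp only [Pi.mul_apply, Pi.add_apply, Pi.inv_apply, hL, logDeriv_apply, h4]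
    rw [mul_right_comm (iteratedDeriv k f z), h5]
    field_simp
    ring
  rw [proximity_congr_codiscrete hkey (by linarith)]
  have h1 := proximity_mul_top_le (((hf.meromorphic.iteratedDeriv k).mul hf.meromorphic.inv).mul
    (meromorphic_inv_pow l)) ((hc 1).add (((hc (-1)).mul hLm.inv).mul hGm)) r
  have h2 := proximity_mul_top_le ((hf.meromorphic.iteratedDeriv k).mul hf.meromorphic.inv)
    (meromorphic_inv_pow l) r
  have h3 := proximity_add_top_le (hc 1) (((hc (-1)).mul hLm.inv).mul hGm) r
  have h4 := proximity_mul_top_le ((hc (-1)).mul hLm.inv) hGm r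
  have h5 := proximity_mul_top_le (hc (-1)) hLm.inv r
  have h6 := proximity_iteratedDeriv_mul_inv_le hf.meromorphic hf.order_ne_top
    (fun j hj ↦ hf.order_iteratedDeriv_ne_top j hj.le) hr h
  have h7 := proximity_inv_pow (l := l) hr
  have h8 : ∀ c : ℂ, ‖c‖ = 1 → proximity (fun _ : ℂ ↦ c) ⊤ r = 0 := fun c hc ↦ by
    rw [proximity_const, hc]
    simp
  simp only [Pi.add_apply] at h1 h2 h3 h4 h5
  rw [h7] at h2
  rw [h8 1 (by simp)] at h3
  rw [h8 (-1) (by simp)] at h5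
  linarith

/-- Comparison of the divisors of `f` and of the logarithmic derivative, as counting functions. -/
theorem exists_logCounting_le (hf : MultiplicityConditions k l m n f) :
    ∃ A : ℝ, 0 ≤ A ∧ ∀ r : ℝ, 1 ≤ r → (m * n : ℝ) * (logCounting f 0 r -
      Function.locallyFinsuppWithin.logCounting (MeromorphicOn.divisor
        (logDeriv fun w ↦ iteratedDerivDivPow k l f w - 1) univ) r) ≤
      m * (k + 1) * logCounting f 0 r + m * logCounting f ⊤ r +
      n * logCounting (fun w ↦ iteratedDerivDivPow k l f w - 1) 0 r + A * Real.log r := by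
  set F := fun w ↦ iteratedDerivDivPow k l f w - 1
  have hL : Meromorphic (logDeriv F) := hf.meromorphic_sub_one.logDeriv
  obtain ⟨A, hA, h⟩ := exists_logCounting_le_of_forall_ne_zero
    (D₁ := (m * n) • ((MeromorphicOn.divisor f univ)⁺ - MeromorphicOn.divisor (logDeriv F) univ))
    (D₂ := (m * (k + 1)) • (MeromorphicOn.divisor f univ)⁺ +
      m • (MeromorphicOn.divisor f univ)⁻ + n • (MeromorphicOn.divisor F univ)⁺) fun z hz ↦ by
    have h1 := (coe_divisor_univ hf.meromorphic (hf.order_ne_top z)).symm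
    have h2 := (coe_divisor_univ hf.meromorphic_sub_one (hf.order_sub_one_ne_top z)).symm
    have h3 := (coe_divisor_univ hL (hf.order_logDeriv_ne_top z)).symm
    have h4 := mul_posPart_sub_divisor_logDeriv_le hf.meromorphic hf.lt hz h1 h2 h3
      (hf.le_of_pos z hz _ h1) (hf.le_of_neg z hz _ h1) (hf.le_of_sub_one_pos z hz _ h2)
    simpa [Function.locallyFinsuppWithin.posPart_apply,
      Function.locallyFinsuppWithin.negPart_apply] using h4
  refine ⟨A, hA, fun r hr ↦ ?_⟩
  have h1 := h r hr
  simp only [map_nsmul, map_add, map_sub, ← logCounting_zero, ← logCounting_top, Pi.add_apply,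
    Pi.smul_apply, Pi.sub_apply, nsmul_eq_mul] at h1
  push_cast at h1
  exact h1

/-- The counting function of the poles of `iteratedDerivDivPow k l f`. -/
theorem exists_logCounting_derivDivPow_le (hf : MultiplicityConditions k l m n f) :
    ∃ A : ℝ, 0 ≤ A ∧ ∀ r : ℝ, 1 ≤ r → n * logCounting (iteratedDerivDivPow k l f) ⊤ r ≤
      (n + k) * logCounting f ⊤ r + A * Real.log r := by
  obtain ⟨A, hA, h⟩ := exists_logCounting_le_of_forall_ne_zero
    (D₁ := n • (MeromorphicOn.divisor (iteratedDerivDivPow k l f) univ)⁻)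
    (D₂ := (n + k) • (MeromorphicOn.divisor f univ)⁻) fun z hz ↦ by
    have h1 := (coe_divisor_univ hf.meromorphic (hf.order_ne_top z)).symm
    have h2 := (coe_divisor_univ hf.meromorphic_derivDivPow (hf.order_derivDivPow_ne_top z)).symm
    have h4 := hf.le_of_neg z hz _ h1
    simp only [Function.locallyFinsuppWithin.coe_nsmul, Pi.smul_apply,
      Function.locallyFinsuppWithin.negPart_apply, nsmul_eq_mul]
    set p := MeromorphicOn.divisor f univ z
    set g := MeromorphicOn.divisor (iteratedDerivDivPow k l f) univ z
    rcases lt_or_ge p 0 with hp | hp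
    · have h3 := meromorphicOrderAt_iteratedDerivDivPow_eq (l := l) hz h1 (k := k)
        fun j _ ↦ by omega
      have h5 : g = p - k := by exact_mod_cast h2.symm.trans h3
      rw [h5, negPart_eq_neg.2 hp.le, negPart_eq_neg.2 (by omega)]
      push_cast
      have h6 : (k : ℤ) * n ≤ k * -p := mul_le_mul_of_nonneg_left (by linarith [h4 hp]) (by simp)
      linarith
    · have h3 : 0 ≤ g := by
        have h3 := meromorphicOrderAt_iteratedDeriv_nonneg (hf.meromorphic z)
          (by rw [h1]; exact_mod_cast hp) k
        rw [← meromorphicOrderAt_iteratedDerivDivPow hz (l := l), h2] at h3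
        exact_mod_cast h3
      rw [negPart_eq_zero.2 h3, mul_zero]
      exact mul_nonneg (by positivity) (negPart_nonneg _)
  refine ⟨A, hA, fun r hr ↦ ?_⟩
  have h1 := h r hr
  simp only [map_nsmul, ← logCounting_top, Pi.smul_apply, nsmul_eq_mul] at h1
  push_cast at h1
  exact h1

theorem exists_characteristic_derivDivPow_le (hf : MultiplicityConditions k l m n f) :
    ∃ A : ℝ, 0 ≤ A ∧ ∀ r : ℝ, 1 ≤ r → ∀ s,
      (∀ j < k, proximity (logDeriv (iteratedDeriv j f)) ⊤ r ≤ s) →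
      n * characteristic (iteratedDerivDivPow k l f) ⊤ r ≤
        (n + k) * characteristic f ⊤ r + n * (k * s) + A * Real.log r := by
  obtain ⟨A, hA, hN⟩ := hf.exists_logCounting_derivDivPow_le
  refine ⟨A, hA, fun r hr s h ↦ ?_⟩
  have hkey : iteratedDerivDivPow k l f =ᶠ[codiscrete ℂ]
      f * (iteratedDeriv k f * f⁻¹) * fun z ↦ (z ^ l)⁻¹ := by
    filter_upwards [eventually_codiscrete_ne_zero hf.meromorphic hf.order_ne_top] with z hz
    simp only [iteratedDerivDivPow, Pi.mul_apply, Pi.inv_apply]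
    field_simp
  have hq : Meromorphic (iteratedDeriv k f * f⁻¹) :=
    (hf.meromorphic.iteratedDeriv k).mul hf.meromorphic.inv
  have h1 := proximity_mul_top_le (hf.meromorphic.mul hq) (meromorphic_inv_pow l) r
  have h2 := proximity_mul_top_le hf.meromorphic hq r
  have h3 := proximity_iteratedDeriv_mul_inv_le hf.meromorphic hf.order_ne_top
    (fun j hj ↦ hf.order_iteratedDeriv_ne_top j hj.le) hr h
  rw [← proximity_congr_codiscrete hkey (by linarith), Pi.add_apply, proximity_inv_pow hr] at h1
  rw [Pi.add_apply] at h2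
  have h4 : (n : ℝ) * proximity (iteratedDerivDivPow k l f) ⊤ r ≤
      n * (proximity f ⊤ r + k * s) := by
    gcongr
    linarith
  have h5 : (0 : ℝ) ≤ k * proximity f ⊤ r := mul_nonneg (by positivity) (proximity_nonneg r)
  have h6 := hN r hr
  simp only [characteristic, Pi.add_apply] at h6 ⊢
  linarith

/-- The main estimate: up to error terms, the characteristic function of `f` is bounded by a
multiple of itself. -/
theorem exists_mul_characteristic_le (hf : MultiplicityConditions k l m n f) :
    ∃ C : ℝ, 0 ≤ C ∧ ∀ r : ℝ, 1 ≤ r → ∀ s, 0 ≤ s →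
      (∀ j < k, proximity (logDeriv (iteratedDeriv j f)) ⊤ r ≤ s) →
      proximity (logDeriv (iteratedDerivDivPow k l f)) ⊤ r ≤ s →
      proximity (logDeriv fun w ↦ iteratedDerivDivPow k l f w - 1) ⊤ r ≤ s →
      (m * n : ℝ) * characteristic f ⊤ r ≤
        (m * (k + 2) + n + k) * characteristic f ⊤ r + C * (s + 1 + Real.log r) := by
  obtain ⟨A₁, hA₁, hcount⟩ := hf.exists_logCounting_le
  obtain ⟨A₂, hA₂, hchar⟩ := hf.exists_characteristic_derivDivPow_le
  obtain ⟨c₁, hc₁, hJ⟩ := exists_proximity_inv_le hf.meromorphic_sub_one.logDeriv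
  obtain ⟨c₂, hc₂, hinv⟩ := exists_characteristic_inv_le hf.meromorphic
  obtain ⟨c₃, hc₃, hNf⟩ := exists_logCounting_zero_le hf.meromorphic
  obtain ⟨c₄, hc₄, hNF⟩ := exists_logCounting_zero_le hf.meromorphic_sub_one
  have hlog2 := Real.log_nonneg (one_le_two (α := ℝ))
  refine ⟨m * n * (k + 2) + n * k + (m * n * (c₁ + c₂ + Real.log 2) + m * (k + 1) * c₃ +
    n * (c₄ + Real.log 2)) + (A₁ + A₂), by positivity, fun r hr s hs h hG hF ↦ ?_⟩
  have hlog := Real.log_nonneg hr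
  have h1 := hf.proximity_inv_le hr h hG
  have h2 := hJ r hr
  have h3 := (hinv r).2
  have h4 : characteristic f⁻¹ ⊤ r = proximity f⁻¹ ⊤ r + logCounting f 0 r := by
    rw [characteristic, Pi.add_apply, logCounting_inv]
  have h5 : (m * n : ℝ) * characteristic f ⊤ r ≤ m * n * (((k + 2) * s + (c₁ + c₂ + Real.log 2)) +
      (logCounting f 0 r - Function.locallyFinsuppWithin.logCounting (MeromorphicOn.divisor
        (logDeriv fun w ↦ iteratedDerivDivPow k l f w - 1) univ) r)) := by
    gcongr
    linarith
  have h6 := hcount r hr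
  have h7 : (m * (k + 1) : ℝ) * logCounting f 0 r ≤
    m * (k + 1) * (characteristic f ⊤ r + c₃) := by gcongr; exact hNf r
  have h8 : (m : ℝ) * logCounting f ⊤ r ≤ m * characteristic f ⊤ r := by
    gcongr
    have : 0 ≤ proximity f ⊤ r := proximity_nonneg r
    rw [characteristic, Pi.add_apply]
    linarith
  have h9 : (n : ℝ) * logCounting (fun w ↦ iteratedDerivDivPow k l f w - 1) 0 r ≤
      n * (characteristic (iteratedDerivDivPow k l f) ⊤ r + (c₄ + Real.log 2)) := by
    gcongr
    linarith [hNF r, (abs_le.1 (abs_characteristic_sub_one_sub_le hf.meromorphic_derivDivPow r)).1]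
  have h10 := hchar r hr s h
  set c := m * n * (c₁ + c₂ + Real.log 2) + m * (k + 1) * c₃ + n * (c₄ + Real.log 2) with hc
  set B : ℝ := m * n * (k + 2) + n * k with hB
  have hB0 : 0 ≤ B := by positivity
  have hc0 : 0 ≤ c := by positivity
  have h11 : B * s + c + (A₁ + A₂) * Real.log r ≤ (B + c + (A₁ + A₂)) * (s + 1 + Real.log r) := by
    nlinarith [mul_nonneg hB0 hlog, mul_nonneg hc0 hlog, mul_nonneg hc0 hs,
      mul_nonneg (add_nonneg hA₁ hA₂) hs]
  have h12 : (m * n : ℝ) * characteristic f ⊤ r ≤ (m * (k + 2) + n + k) * characteristic f ⊤ r +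
      (B * s + c + (A₁ + A₂) * Real.log r) := by
    rw [hB, hc]
    linarith
  linarith

end MultiplicityConditions

theorem le_of_error_terms {T S s ρ C C' N ε : ℝ} (hT : 0 ≤ T) (hs : 0 ≤ s) (hρ : 0 ≤ ρ)
    (hC : 0 ≤ C) (hN : 0 ≤ N) (hε : 0 ≤ ε) (hεN : ε * N * (C + 1) ≤ 1 / 4)
    (h₁ : T ≤ C * (s + ρ)) (h₂ : S ≤ N * (T + s + ρ)) (h₃ : s ≤ ε * S + C' * ρ) :
    T ≤ 2 * C * (2 + 2 * C') * ρ := by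
  have hδ : 0 ≤ ε * N := by positivity
  have h4 := mul_le_mul_of_nonneg_left h₂ hε
  have h5 : ε * N ≤ 1 / 4 := (le_mul_of_one_le_right hδ (by linarith)).trans hεN
  have h6 : s ≤ ε * N * (T + s + ρ) + C' * ρ := by linarith
  have h7 : s ≤ 2 * (ε * N) * T + (1 + 2 * C') * ρ := by
    linarith [mul_le_mul_of_nonneg_right h5 hs, mul_le_mul_of_nonneg_right h5 hρ,
      mul_nonneg hδ hT]
  have h8 : C * s ≤ C * (2 * (ε * N) * T + (1 + 2 * C') * ρ) := by gcongr
  have h9 : C * (2 * (ε * N)) ≤ 1 / 2 := by linarith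
  linarith [mul_le_mul_of_nonneg_right h9 hT]

namespace MultiplicityConditions

variable {k l m n : ℕ} {f : ℂ → ℂ}

/-- The functions to which the lemma on the logarithmic derivative is applied. -/
def logDerivFamily (k l : ℕ) (f : ℂ → ℂ) (j : ℕ) : ℂ → ℂ :=
  if j < k then iteratedDeriv j f
  else if j = k then iteratedDerivDivPow k l f
  else fun w ↦ iteratedDerivDivPow k l f w - 1

theorem exists_characteristic_logDerivFamily_le (hf : MultiplicityConditions k l m n f) :
    ∃ M : ℝ, 0 ≤ M ∧ ∀ r : ℝ, 1 ≤ r → ∀ s, 0 ≤ s →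
      (∀ j < k, proximity (logDeriv (iteratedDeriv j f)) ⊤ r ≤ s) →
      ∀ j, characteristic (logDerivFamily k l f j) ⊤ r ≤
        M * (characteristic f ⊤ r + s + (1 + Real.log r)) := by
  obtain ⟨A, hA, hchar⟩ := hf.exists_characteristic_derivDivPow_le
  have hlog2 := Real.log_nonneg (one_le_two (α := ℝ))
  refine ⟨2 ^ k + (n + k) + n * k + A + Real.log 2, by positivity, fun r hr s hs h j ↦ ?_⟩
  have hlog := Real.log_nonneg hr
  have hT : 0 ≤ characteristic f ⊤ r := characteristic_nonneg hr
  have hn : (1 : ℝ) ≤ n := by exact_mod_cast (Nat.zero_le k).trans_lt hf.lt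
  set X := characteristic f ⊤ r + s + (1 + Real.log r) with hX
  have hX0 : 0 ≤ X := by positivity
  have hG : characteristic (iteratedDerivDivPow k l f) ⊤ r ≤ ((n + k) + n * k + A) * X := by
    have h1 := hchar r hr s h
    have h2 : 0 ≤ characteristic (iteratedDerivDivPow k l f) ⊤ r := characteristic_nonneg hr
    have h3 : (n + k : ℝ) * characteristic f ⊤ r ≤ (n + k) * X := by gcongr; linarith
    have h4 : (n * k : ℝ) * s ≤ n * k * X := by gcongr; linarith
    have h5 : A * Real.log r ≤ A * X := by gcongr; linarith
    nlinarith
  have hpow : (0 : ℝ) ≤ 2 ^ k * X := by positivity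
  have hlogX : Real.log 2 ≤ Real.log 2 * X := le_mul_of_one_le_right hlog2 (by linarith)
  have hrest : 0 ≤ ((n + k) + n * k + A) * X := by positivity
  rw [logDerivFamily]
  split_ifs with h1 h2
  · have h3 := characteristic_iteratedDeriv_add_le hf.meromorphic
      (fun i (hi : i < j) ↦ hf.order_iteratedDeriv_ne_top i (hi.trans h1).le) hr
      fun i hi ↦ h i (hi.trans h1)
    have h4 : (2 : ℝ) ^ j * (characteristic f ⊤ r + s) ≤ 2 ^ k * X := by
      gcongr
      · exact one_le_two
      · linarith
    linarith
  · linarith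
  · have h3 := (abs_le.1 (abs_characteristic_sub_one_sub_le hf.meromorphic_derivDivPow r)).1
    linarith

/-- Under the multiplicity conditions, the characteristic function of `f` is bounded by a multiple
of `log r` along an unbounded set of radii. -/
theorem exists_characteristic_le_log (hf : MultiplicityConditions k l m n f)
    (hlt : m * (k + 2) + n + k < m * n) :
    ∃ K : ℝ, ∀ r₀ : ℝ, ∃ r, r₀ ≤ r ∧ 1 ≤ r ∧ characteristic f ⊤ r ≤ K * (1 + Real.log r) := by
  obtain ⟨C, hC, hmain⟩ := hf.exists_mul_characteristic_le
  obtain ⟨M, hM, hfam⟩ := hf.exists_characteristic_logDerivFamily_le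
  have hmero : ∀ j ∈ Finset.range (k + 2), Meromorphic (logDerivFamily k l f j) := fun j _ ↦ by
    rw [logDerivFamily]
    split_ifs
    exacts [hf.meromorphic.iteratedDeriv j, hf.meromorphic_derivDivPow, hf.meromorphic_sub_one]
  have hord : ∀ j ∈ Finset.range (k + 2), ∀ z,
      meromorphicOrderAt (logDerivFamily k l f j) z ≠ ⊤ := fun j _ z ↦ by
    rw [logDerivFamily]
    split_ifs with h1
    exacts [hf.order_iteratedDeriv_ne_top j h1.le z, hf.order_derivDivPow_ne_top z,
      hf.order_sub_one_ne_top z]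
  set N : ℝ := (k + 2) * M with hN
  have hN0 : 0 ≤ N := by positivity
  obtain ⟨C', hC', hlogD⟩ := exists_proximity_logDeriv_le_mul_sum hmero hord
    (ε := 1 / (4 * (N + 1) * (C + 1))) (by positivity)
  refine ⟨2 * C * (2 + 2 * C'), fun r₀ ↦ ?_⟩
  obtain ⟨r, hr₀, hr, hle⟩ := hlogD r₀
  refine ⟨r, hr₀, hr, ?_⟩
  have hδ : 1 / (4 * (N + 1) * (C + 1)) * N * (C + 1) ≤ 1 / 4 := by
    rw [div_mul_eq_mul_div, div_mul_eq_mul_div, div_le_iff₀ (by positivity)]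
    nlinarith
  have hlog := Real.log_nonneg hr
  have hT : 0 ≤ characteristic f ⊤ r := characteristic_nonneg hr
  have hS0 : 0 ≤ ∑ j ∈ Finset.range (k + 2), characteristic (logDerivFamily k l f j) ⊤ r :=
    Finset.sum_nonneg fun j _ ↦ characteristic_nonneg hr
  have hε0 : 0 ≤ 1 / (4 * (N + 1) * (C + 1)) := by positivity
  generalize 1 / (4 * (N + 1) * (C + 1)) = ε at hle hε0 hδ
  generalize hS : ∑ j ∈ Finset.range (k + 2), characteristic (logDerivFamily k l f j) ⊤ r = S
    at hle hS0
  have hs0 : 0 ≤ ε * S + C' * (1 + Real.log r) :=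
    add_nonneg (mul_nonneg hε0 hS0) (mul_nonneg hC' (by linarith))
  generalize hs : ε * S + C' * (1 + Real.log r) = s at hle hs0
  have h1 : ∀ j < k, proximity (logDeriv (iteratedDeriv j f)) ⊤ r ≤ s := fun j hj ↦ by
    have := hle j (Finset.mem_range.2 (by omega))
    rwa [logDerivFamily, if_pos hj] at this
  have h2 : proximity (logDeriv (iteratedDerivDivPow k l f)) ⊤ r ≤ s := by
    have := hle k (Finset.mem_range.2 (by omega))
    rwa [logDerivFamily, if_neg (lt_irrefl k), if_pos rfl] at this
  have h3 : proximity (logDeriv fun w ↦ iteratedDerivDivPow k l f w - 1) ⊤ r ≤ s := by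
    have := hle (k + 1) (Finset.mem_range.2 (by omega))
    rwa [logDerivFamily, if_neg (by omega), if_neg (by omega)] at this
  have h4 : S ≤ N * (characteristic f ⊤ r + s + (1 + Real.log r)) := by
    rw [← hS]
    refine (Finset.sum_le_card_nsmul _ _ _ fun j _ ↦ hfam r hr s hs0 h1 j).trans (le_of_eq ?_)
    rw [Finset.card_range, nsmul_eq_mul, hN]
    push_cast
    ring
  have h5 := hmain r hr s hs0 h1 h2 h3
  have h6 : (m * (k + 2) + n + k + 1 : ℝ) ≤ m * n := by exact_mod_cast hlt
  have h7 := mul_le_mul_of_nonneg_right h6 hT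
  refine le_of_error_terms hT hs0 (by linarith) hC hN0 hε0 hδ (ρ := 1 + Real.log r) ?_ h4 hs.ge
  linarith

end MultiplicityConditions

theorem merOrder_eq_meromorphicOrderAt {f : ℂ → ℂ} {z : ℂ} (hf : MeromorphicAt f z) :
    merOrder f z = meromorphicOrderAt f z := by
  by_cases h : ∀ᶠ w in 𝓝[≠] z, f w = 0
  · rw [merOrder, if_pos h]
    exact (meromorphicOrderAt_eq_top_iff.2 h).symm
  · obtain ⟨p, hp⟩ := WithTop.ne_top_iff_exists.1 (mt meromorphicOrderAt_eq_top_iff.1 h)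
    have hex : ∃ n : ℤ, ∃ g : ℂ → ℂ, AnalyticAt ℂ g z ∧ g z ≠ 0 ∧
        ∀ᶠ w in 𝓝[≠] z, f w = (w - z) ^ n * g w :=
      ⟨p, (meromorphicOrderAt_eq_int_iff hf).1 hp.symm⟩
    rw [merOrder, if_neg h, dif_pos hex]
    exact ((meromorphicOrderAt_eq_int_iff hf).2 hex.choose_spec).symm

theorem meromorphicOrderAt_iteratedDerivDivPow_sub {f : ℂ → ℂ} {k l : ℕ} (c : ℂ) {z : ℂ}
    (hz : z ≠ 0) : meromorphicOrderAt (fun w ↦ iteratedDerivDivPow k l f w - c) z =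
      meromorphicOrderAt (fun w ↦ iteratedDeriv k f w - c * w ^ l) z := by
  have h1 : (fun w ↦ iteratedDerivDivPow k l f w - c) =ᶠ[𝓝[≠] z]
      (fun w ↦ (w ^ l)⁻¹) * fun w ↦ iteratedDeriv k f w - c * w ^ l := by
    filter_upwards [nhdsWithin_le_nhds (eventually_ne_nhds hz)] with w hw
    simp only [iteratedDerivDivPow, Pi.mul_apply]
    field_simp
  rw [meromorphicOrderAt_congr h1]
  exact meromorphicOrderAt_mul_of_ne_zero (by fun_prop (disch := exact pow_ne_zero _ hz))
    (inv_ne_zero (pow_ne_zero _ hz))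

theorem meromorphicOrderAt_iteratedDeriv_eq_top {f : ℂ → ℂ} {j k : ℕ} (hjk : j ≤ k) {z : ℂ}
    (h : meromorphicOrderAt (iteratedDeriv j f) z = ⊤) :
    meromorphicOrderAt (iteratedDeriv k f) z = ⊤ := by
  induction k, hjk using Nat.le_induction with
  | base => exact h
  | succ k _ ih =>
    have h1 : iteratedDeriv k f =ᶠ[𝓝[≠] z] fun _ ↦ 0 := meromorphicOrderAt_eq_top_iff.1 ih
    rw [iteratedDeriv_succ, meromorphicOrderAt_congr h1.nhdsNE_deriv]
    simp [meromorphicOrderAt_const]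

theorem multiplicityConditions_of_merOrder {k l m n : ℕ} {H : ℂ → ℂ} (hkn : k < n)
    (hH : MeromorphicNiceOn H univ)
    (htr : ¬∃ P Q : Polynomial ℂ, Q ≠ 0 ∧ ∀ z : ℂ, Q.eval z ≠ 0 → H z = P.eval z / Q.eval z)
    (hzero : ∀ z, H z = 0 → ((n : ℤ) : WithTop ℤ) ≤ merOrder H z)
    (hpole : ∀ z, z ≠ 0 → merOrder H z < 0 → merOrder H z ≤ ((-(n : ℤ) : ℤ) : WithTop ℤ))
    (hone : ∀ z, iteratedDeriv k H z - z ^ l = 0 →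
      ((m : ℤ) : WithTop ℤ) ≤ merOrder (fun w ↦ iteratedDeriv k H w - w ^ l) z) :
    MultiplicityConditions k l m n H := by
  have hm : Meromorphic H := fun z ↦ hH.1 z (mem_univ z)
  have hnice := fun z ↦ hH.2 z (mem_univ z)
  have hG := hm.iteratedDerivDivPow k l
  have hsub : ∀ c : ℂ, ∀ z, meromorphicOrderAt (fun w ↦ iteratedDerivDivPow k l H w - c) z ≠ ⊤ :=
    fun c ↦ by
      have hGc : Meromorphic fun w ↦ iteratedDerivDivPow k l H w - c := fun z ↦ by
        have := hG z
        fun_prop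
      refine hGc.exists_meromorphicOrderAt_ne_top_iff_forall.1 ⟨1, fun h ↦ htr ?_⟩
      rw [meromorphicOrderAt_iteratedDerivDivPow_sub c one_ne_zero] at h
      exact exists_polynomial_of_iteratedDeriv_sub_eq_top hm hnice h
  have hF : Meromorphic fun w ↦ iteratedDerivDivPow k l H w - 1 := fun z ↦ by
    have := hG z
    fun_prop
  refine ⟨hm, fun j hj z h ↦ htr ?_, hsub 1, fun z h ↦ ?_, hkn, fun z _ p hp hp0 ↦ ?_,
    fun z hz p hp hp0 ↦ ?_, fun z hz q hq hq0 ↦ ?_⟩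
  · exact exists_polynomial_of_iteratedDeriv_sub_eq_top (c := 0) (l := l) hm hnice
      (by simpa using meromorphicOrderAt_iteratedDeriv_eq_top hj h)
  · obtain ⟨c, w, hw⟩ := exists_meromorphicOrderAt_sub_const_eq_top hF h
    refine hsub (1 + c) w ?_
    simpa only [sub_sub] using hw
  · have h1 : 0 < meromorphicOrderAt H z := by rw [hp]; exact_mod_cast hp0
    have h2 := analyticAt_of_meromorphicOrderAt_nonneg (hm z) (hnice z) h1.le
    have h3 := tendsto_nhds_unique (h2.continuousAt.tendsto.mono_left nhdsWithin_le_nhds)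
      ((tendsto_zero_iff_meromorphicOrderAt_pos (hm z)).2 h1)
    have h4 := hzero z h3
    rw [merOrder_eq_meromorphicOrderAt (hm z), hp] at h4
    exact_mod_cast h4
  · have h1 := hpole z hz
    rw [merOrder_eq_meromorphicOrderAt (hm z), hp] at h1
    have h2 := h1 (by exact_mod_cast hp0)
    exact_mod_cast h2
  · have hD : MeromorphicAt (fun w ↦ iteratedDeriv k H w - w ^ l) z := by
      have := hm.iteratedDeriv k z
      fun_prop
    have h1 : 0 < meromorphicOrderAt (fun w ↦ iteratedDeriv k H w - w ^ l) z := by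
      have := meromorphicOrderAt_iteratedDerivDivPow_sub (f := H) (k := k) (l := l) 1 hz
      simp only [one_mul] at this
      rw [← this, hq]
      exact_mod_cast hq0
    have h2 : 0 ≤ meromorphicOrderAt H z := by
      by_contra! hneg
      obtain ⟨p, hp⟩ := WithTop.ne_top_iff_exists.1 hneg.ne_top
      rw [← hp] at hneg
      have hp0 : p < 0 := by exact_mod_cast hneg
      have h3 := meromorphicOrderAt_iteratedDerivDivPow_eq (l := l) hz hp.symm (k := k)
        fun j _ ↦ by omega
      have h4 : p - (k : ℤ) < 0 := by omega
      rw [meromorphicOrderAt_sub_one_eq (by rw [h3]; exact_mod_cast h4), h3] at hq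
      have h5 : p - k = q := by exact_mod_cast hq
      omega
    have h3 := analyticAt_of_meromorphicOrderAt_nonneg (hm z) (hnice z) h2
    have h4 : ContinuousAt (fun w ↦ iteratedDeriv k H w - w ^ l) z := by
      have : ContinuousAt (iteratedDeriv k H) z := by
        rw [iteratedDeriv_eq_iterate]
        exact (h3.iterated_deriv k).continuousAt
      fun_prop
    have h5 := tendsto_nhds_unique (h4.tendsto.mono_left nhdsWithin_le_nhds)
      ((tendsto_zero_iff_meromorphicOrderAt_pos hD).2 h1)
    have h6 := hone z h5
    rw [merOrder_eq_meromorphicOrderAt hD,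
      ← one_mul (m : ℤ)] at h6
    have h7 := meromorphicOrderAt_iteratedDerivDivPow_sub (f := H) (k := k) (l := l) 1 hz
    simp only [one_mul] at h6 h7
    rw [← h7, hq] at h6
    exact_mod_cast h6

theorem mul_add_lt_of_condition {k l m n : ℕ} (hm : 1 ≤ m) (hn : 1 ≤ n)
    (hcond : ((k : ℝ) + 2 * ((l : ℝ) + 1)) / n + ((l : ℝ) + 1) / m +
      (k : ℝ) * ((l : ℝ) + 1) / ((m : ℝ) * n) < 1) : m * (k + 2) + n + k < m * n := by
  have hm' : (0 : ℝ) < m := by exact_mod_cast hm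
  have hn' : (0 : ℝ) < n := by exact_mod_cast hn
  have h1 : ((k : ℝ) + 2 * ((l : ℝ) + 1)) / n + ((l : ℝ) + 1) / m +
      (k : ℝ) * ((l : ℝ) + 1) / ((m : ℝ) * n) =
      (m * (k + 2 * (l + 1)) + n * (l + 1) + k * (l + 1)) / (m * n) := by
    field_simp
  rw [h1, div_lt_one (by positivity)] at hcond
  have h2 : m * (k + 2 * (l + 1)) + n * (l + 1) + k * (l + 1) < m * n := by exact_mod_cast hcond
  nlinarith [Nat.zero_le (m * l), Nat.zero_le (n * l), Nat.zero_le (k * l)]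

/-- **Transcendental-case non-existence claim.** If `(k + 2(l+1))/n + (l+1)/m + k(l+1)/(mn) < 1`
then there is no transcendental meromorphic function `H` on `ℂ` with `H 0 ≠ 0`, all zeros of
multiplicity at least `n`, all non-zero poles of multiplicity at least `n`, and all zeros of
`H⁽ᵏ⁾(ζ) − ζ^l` of multiplicity at least `m`. -/
theorem no_transcendental (k m n : ℕ) (l : ℕ) (hk : 1 ≤ k) (hm : 1 ≤ m) (hn : 1 ≤ n)
    (hcond : ((k : ℝ) + 2 * ((l : ℝ) + 1)) / n + ((l : ℝ) + 1) / m +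
      (k : ℝ) * ((l : ℝ) + 1) / ((m : ℝ) * n) < 1) :
    ¬∃ H : ℂ → ℂ, MeromorphicNiceOn H Set.univ ∧
      -- H is transcendental, i.e. not rational
      (¬∃ P Q : Polynomial ℂ, Q ≠ 0 ∧ ∀ z : ℂ, Q.eval z ≠ 0 → H z = P.eval z / Q.eval z) ∧
      H 0 ≠ 0 ∧
      -- all zeros of H have multiplicity at least n
      (∀ z : ℂ, H z = 0 → ((n : ℤ) : WithTop ℤ) ≤ merOrder H z) ∧
      -- all non-zero poles of H have multiplicity at least n
      (∀ z : ℂ, z ≠ 0 → merOrder H z < 0 → merOrder H z ≤ ((-(n : ℤ) : ℤ) : WithTop ℤ)) ∧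
      -- all zeros of H⁽ᵏ⁾(ζ) − ζ^l have multiplicity at least m
      (∀ z : ℂ, iteratedDeriv k H z - z ^ l = 0 →
        ((m : ℤ) : WithTop ℤ) ≤ merOrder (fun w => iteratedDeriv k H w - w ^ l) z) := by
  rintro ⟨H, hH, htr, -, hzero, hpole, hone⟩
  have hlt := mul_add_lt_of_condition hm hn hcond
  have hkn : k < n := by nlinarith
  have hf := multiplicityConditions_of_merOrder hkn hH htr hzero hpole hone
  obtain ⟨K, hK⟩ := hf.exists_characteristic_le_log hlt
  exact htr (exists_polynomial_eq_div_of_characteristic_le_log hf.meromorphic hf.order_ne_top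
    (fun z ↦ hH.2 z (mem_univ z)) hK)

end
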